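/- Let Ω be a domain in ℂⁿ, z₀ ∈ Ω, and 1 < p < ∞. Suppose f = u + iv is holomorphic on Ω with v(z₀) = 0, and suppose |u|^p admits a harmonic majorant on Ω. Then |f|^p admits a harmonic majorant on Ω, and there is a constant C_p > 0 depending only on p (in particular, independent of n, Ω and z₀) such that inf{F(z₀) : F harmonic on Ω, |f|^p ≤ F on Ω} ≤ C_p^p · inf{U(z₀) : U harmonic on Ω, |u|^p ≤ U on Ω}. -/

import Mathlib

open Real MeasureTheory Set

/-- A real-valued function on an open set `Ω ⊆ ℂⁿ` is harmonic if it is `C²` there and its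
Laplacian with respect to the underlying real coordinates of `ℂⁿ ≅ ℝ^{2n}` vanishes identically. -/
def HarmonicOnCn {n : ℕ} (U : EuclideanSpace ℂ (Fin n) → ℝ)
    (Ω : Set (EuclideanSpace ℂ (Fin n))) : Prop :=
  ContDiffOn ℝ 2 U Ω ∧ ∀ z ∈ Ω,
    (∑ j : Fin n,
      (fderiv ℝ (fderiv ℝ U) z (EuclideanSpace.single j (1:ℂ)) (EuclideanSpace.single j (1:ℂ)) +
        fderiv ℝ (fderiv ℝ U) z (EuclideanSpace.single j Complex.I)
          (EuclideanSpace.single j Complex.I))) = 0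


section Part1
open Filter Topology

variable {E F G : Type*} [NormedAddCommGroup E] [NormedSpace ℝ E]
  [NormedAddCommGroup F] [NormedSpace ℝ F] [NormedAddCommGroup G] [NormedSpace ℝ G]

/-- second directional derivative -/
noncomputable def D2 (f : E → F) (z e : E) : F := fderiv ℝ (fderiv ℝ f) z e e

lemma line_hasDerivAt (z e : E) (t : ℝ) : HasDerivAt (fun t : ℝ => z + t • e) e t := by
  simpa using ((hasDerivAt_id t).smul_const e).const_add z

lemma line_tendsto (z e : E) : Tendsto (fun t : ℝ => z + t • e) (𝓝 0) (𝓝 z) := by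
  have := (line_hasDerivAt z e 0).continuousAt.tendsto
  simpa using this

lemma line_first {f : E → F} {z : E} (h : ContDiffAt ℝ 2 f z) (e : E) :
    ∀ᶠ t in 𝓝 (0:ℝ), HasDerivAt (fun t : ℝ => f (z + t • e)) (fderiv ℝ f (z + t • e) e) t := by
  have h1 : ∀ᶠ x in 𝓝 z, ContDiffAt ℝ 2 f x := h.eventually (by simp)
  filter_upwards [(line_tendsto z e).eventually h1] with t ht
  exact ((ht.differentiableAt (by norm_num)).hasFDerivAt).comp_hasDerivAt t (line_hasDerivAt z e t)

lemma line_second {f : E → F} {z : E} (h : ContDiffAt ℝ 2 f z) (e : E) :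
    HasDerivAt (fun t : ℝ => fderiv ℝ f (z + t • e) e) (D2 f z e) 0 := by
  have h1 : DifferentiableAt ℝ (fderiv ℝ f) z :=
    (h.fderiv_right (m := 1) (by norm_num)).differentiableAt (by norm_num)
  have h1' : HasFDerivAt (fderiv ℝ f) (fderiv ℝ (fderiv ℝ f) z) (z + (0:ℝ) • e) := by
    simpa using h1.hasFDerivAt
  have h2 := h1'.comp_hasDerivAt (0:ℝ) (line_hasDerivAt z e 0)
  have h3 := h2.clm_apply (hasDerivAt_const (0:ℝ) e)
  simpa [D2] using h3

lemma D2_eq {f : E → F} {z e : E} (h : ContDiffAt ℝ 2 f z) {d : ℝ → F} {D : F}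
    (h1 : ∀ᶠ t in 𝓝 (0:ℝ), HasDerivAt (fun t : ℝ => f (z + t • e)) (d t) t)
    (h2 : HasDerivAt d D 0) : D2 f z e = D := by
  have h3 : d =ᶠ[𝓝 0] (fun t : ℝ => fderiv ℝ f (z + t • e) e) := by
    filter_upwards [h1, line_first h e] with t a b using a.unique b
  exact ((line_second h e).congr_of_eventuallyEq h3).unique h2

lemma D2_nonpos_of_localMax {f : E → ℝ} {z : E} (h : ContDiffAt ℝ 2 f z)
    (hm : IsLocalMax f z) (e : E) : D2 f z e ≤ 0 := by
  by_contra hpos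
  push Not at hpos
  set g : ℝ → ℝ := fun t => f (z + t • e) with hg
  have hd1 : deriv g =ᶠ[𝓝 0] (fun t : ℝ => fderiv ℝ f (z + t • e) e) := by
    filter_upwards [line_first h e] with t a using a.deriv
  have hd2 : HasDerivAt (deriv g) (D2 f z e) 0 := (line_second h e).congr_of_eventuallyEq hd1
  have hgm : IsLocalMax g 0 := by
    have : ∀ᶠ t in 𝓝 (0:ℝ), f (z + t • e) ≤ f z := (line_tendsto z e).eventually hm
    filter_upwards [this] with t ht
    simpa [hg] using ht
  have hz : deriv g 0 = 0 := hgm.deriv_eq_zero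
  have hgc : ContinuousAt g 0 := (line_first h e).self_of_nhds.continuousAt
  have hmin : IsLocalMin g 0 := isLocalMin_of_deriv_deriv_pos (by rw [hd2.deriv]; exact hpos) hz hgc
  have hc : g =ᶠ[𝓝 0] fun _ => g 0 := by
    filter_upwards [hgm, hmin] with t a b using le_antisymm a b
  have hc1 : deriv g =ᶠ[𝓝 0] fun _ => 0 := by
    have := hc.deriv
    simpa using this
  have := hd2.unique ((hasDerivAt_const (0:ℝ) (0:ℝ)).congr_of_eventuallyEq hc1)
  linarith

lemma D2_add {f g : E → F} {z : E} (hf : ContDiffAt ℝ 2 f z) (hg : ContDiffAt ℝ 2 g z) (e : E) :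
    D2 (fun x => f x + g x) z e = D2 f z e + D2 g z e := by
  refine D2_eq (hf.add hg) ?_ ((line_second hf e).add (line_second hg e))
  filter_upwards [line_first hf e, line_first hg e] with t a b using a.add b

lemma D2_clm {f : E → F} {z : E} (hf : ContDiffAt ℝ 2 f z) (L : F →L[ℝ] G) (e : E) :
    D2 (fun x => L (f x)) z e = L (D2 f z e) := by
  refine D2_eq (L.contDiff.contDiffAt.comp z hf) ?_
    (L.hasFDerivAt.comp_hasDerivAt (0:ℝ) (line_second hf e))
  filter_upwards [line_first hf e] with t a using L.hasFDerivAt.comp_hasDerivAt t a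

lemma D2_const_mul {f : E → ℝ} {z : E} (hf : ContDiffAt ℝ 2 f z) (c : ℝ) (e : E) :
    D2 (fun x => c * f x) z e = c * D2 f z e := by
  simpa using D2_clm hf (c • ContinuousLinearMap.id ℝ ℝ) e

lemma D2_congr {f g : E → F} {z : E} (h : f =ᶠ[𝓝 z] g) (e : E) : D2 f z e = D2 g z e := by
  unfold D2
  rw [h.fderiv.fderiv_eq]

/-- affine change of variables -/
lemma D2_affine {f : E → F} {z : E} (c : E) (r : ℝ)
    (hf : ContDiffAt ℝ 2 f (r • (z - c))) (e : E) :
    D2 (fun x => f (r • (x - c))) z e = r ^ 2 • D2 f (r • (z - c)) e := by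
  have hk : ContDiffAt ℝ 2 (fun x => f (r • (x - c))) z := by
    refine ContDiffAt.comp z hf ?_
    exact (contDiff_const.smul (contDiff_id.sub contDiff_const)).contDiffAt
  have hr : ∀ t : ℝ, HasDerivAt (fun t : ℝ => r * t) r t := fun t => by
    simpa using (hasDerivAt_id t).const_mul r
  have hr0 : Tendsto (fun t : ℝ => r * t) (𝓝 0) (𝓝 0) := by
    have := (hr 0).continuousAt.tendsto
    simpa using this
  have key : ∀ t : ℝ, f (r • (z + t • e - c)) = f (r • (z - c) + (r * t) • e) := by
    intro t; congr 1; module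
  refine D2_eq hk (d := fun t => r • fderiv ℝ f (r • (z - c) + (r * t) • e) e) ?_ ?_
  · filter_upwards [hr0.eventually (line_first hf e)] with t a
    have := a.scomp t (hr t)
    exact this.congr_of_eventuallyEq (Eventually.of_forall fun t => key t)
  · have h0 : HasDerivAt (fun t : ℝ => fderiv ℝ f (r • (z - c) + t • e) e)
      (D2 f (r • (z - c)) e) (r * 0) := by simpa using line_second hf e
    have := (h0.scomp (0:ℝ) (hr 0)).const_smul r
    rw [smul_smul, ← sq] at this
    exact this

variable {n : ℕ}

/-- The Laplacian. -/
noncomputable def lapl (f : EuclideanSpace ℂ (Fin n) → F) (z : EuclideanSpace ℂ (Fin n)) : F :=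
  ∑ j : Fin n, (D2 f z (EuclideanSpace.single j (1:ℂ)) + D2 f z (EuclideanSpace.single j Complex.I))

lemma harmonic_iff (U : EuclideanSpace ℂ (Fin n) → ℝ) (Ω : Set (EuclideanSpace ℂ (Fin n))) :
    HarmonicOnCn U Ω ↔ ContDiffOn ℝ 2 U Ω ∧ ∀ z ∈ Ω, lapl U z = 0 := Iff.rfl

lemma lapl_add {f g : EuclideanSpace ℂ (Fin n) → F} {z} (hf : ContDiffAt ℝ 2 f z)
    (hg : ContDiffAt ℝ 2 g z) : lapl (fun x => f x + g x) z = lapl f z + lapl g z := by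
  simp only [lapl, D2_add hf hg, ← Finset.sum_add_distrib]
  exact Finset.sum_congr rfl fun _ _ => by abel

lemma lapl_clm {f : EuclideanSpace ℂ (Fin n) → F} {z} (hf : ContDiffAt ℝ 2 f z) (L : F →L[ℝ] G) :
    lapl (fun x => L (f x)) z = L (lapl f z) := by
  simp only [lapl, D2_clm hf L, map_sum, map_add]

lemma lapl_const_mul {f : EuclideanSpace ℂ (Fin n) → ℝ} {z} (hf : ContDiffAt ℝ 2 f z) (c : ℝ) :
    lapl (fun x => c * f x) z = c * lapl f z := by
  simp only [lapl, D2_const_mul hf c, Finset.mul_sum, mul_add]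

lemma lapl_const (c : F) (z : EuclideanSpace ℂ (Fin n)) : lapl (fun _ => c) z = 0 := by
  simp [lapl, D2]

lemma lapl_congr {f g : EuclideanSpace ℂ (Fin n) → F} {z} (h : f =ᶠ[𝓝 z] g) : lapl f z = lapl g z := by
  simp only [lapl, D2_congr h]

lemma lapl_affine {f : EuclideanSpace ℂ (Fin n) → F} {z} (c) (r : ℝ)
    (hf : ContDiffAt ℝ 2 f (r • (z - c))) :
    lapl (fun x => f (r • (x - c))) z = r ^ 2 • lapl f (r • (z - c)) := by
  simp only [lapl, D2_affine c r hf, Finset.smul_sum, smul_add]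

lemma lapl_nonpos_of_localMax {f : EuclideanSpace ℂ (Fin n) → ℝ} {z} (h : ContDiffAt ℝ 2 f z)
    (hm : IsLocalMax f z) : lapl f z ≤ 0 :=
  Finset.sum_nonpos fun _ _ => add_nonpos (D2_nonpos_of_localMax h hm _)
    (D2_nonpos_of_localMax h hm _)

end Part1


section Part2
open Filter Topology Metric

variable {n : ℕ}

lemma inner_single_one (x : EuclideanSpace ℂ (Fin n)) (j : Fin n) :
    inner ℝ x (EuclideanSpace.single j (1:ℂ)) = (x j).re := by
  rw [PiLp.inner_apply, Finset.sum_eq_single j]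
  · simp [Complex.inner]
  · intro b _ hb; simp [hb]
  · simp

lemma inner_single_I (x : EuclideanSpace ℂ (Fin n)) (j : Fin n) :
    inner ℝ x (EuclideanSpace.single j Complex.I) = (x j).im := by
  rw [PiLp.inner_apply, Finset.sum_eq_single j]
  · simp [Complex.inner]
  · intro b _ hb; simp [hb]
  · simp

lemma inner_real_eq (x y : EuclideanSpace ℂ (Fin n)) :
    inner ℝ x y = ∑ j : Fin n, ((x j).re * (y j).re + (x j).im * (y j).im) := by
  rw [PiLp.inner_apply]
  refine Finset.sum_congr rfl fun j _ => ?_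
  simp [Complex.inner]; ring

lemma normsq_line (x e : EuclideanSpace ℂ (Fin n)) (t : ℝ) :
    ‖x + t • e‖ ^ 2 = ‖x‖ ^ 2 + 2 * t * inner ℝ x e + t ^ 2 * ‖e‖ ^ 2 := by
  rw [norm_add_sq_real, inner_smul_right, norm_smul, mul_pow]
  simp; ring

lemma normsq_line_deriv (x e : EuclideanSpace ℂ (Fin n)) (t : ℝ) :
    HasDerivAt (fun t : ℝ => ‖x + t • e‖ ^ 2) (2 * inner ℝ x e + 2 * t * ‖e‖ ^ 2) t := by
  simp only [normsq_line]
  have h1 := ((hasDerivAt_id t).const_mul 2).mul_const (inner ℝ x e)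
  have h2 := ((hasDerivAt_id t).pow 2).mul_const (‖e‖ ^ 2)
  have := (h1.const_add (‖x‖ ^ 2)).add h2
  refine this.congr_deriv ?_
  simp

lemma normsq_line_deriv2 (x e : EuclideanSpace ℂ (Fin n)) :
    HasDerivAt (fun t : ℝ => 2 * inner ℝ x e + 2 * t * ‖e‖ ^ 2) (2 * ‖e‖ ^ 2) 0 := by
  have h1 := (((hasDerivAt_id (0:ℝ)).const_mul 2).mul_const (‖e‖ ^ 2)).const_add (2 * inner ℝ x e)
  refine h1.congr_deriv ?_
  simp

lemma contDiff_normsq (c : EuclideanSpace ℂ (Fin n)) :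
    ContDiff ℝ 2 (fun x => ‖x - c‖ ^ 2) := (contDiff_id.sub contDiff_const).norm_sq ℝ

lemma D2_normsq (c z e : EuclideanSpace ℂ (Fin n)) :
    D2 (fun x => ‖x - c‖ ^ 2) z e = 2 * ‖e‖ ^ 2 := by
  refine D2_eq (contDiff_normsq c).contDiffAt (Eventually.of_forall fun t => ?_)
    (normsq_line_deriv2 (z - c) e)
  have := normsq_line_deriv (z - c) e t
  simpa only [add_sub_right_comm] using this

lemma lapl_normsq (c z : EuclideanSpace ℂ (Fin n)) :
    lapl (fun x => ‖x - c‖ ^ 2) z = 4 * n := by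
  simp [lapl, D2_normsq]; ring

/-- (viscosity) subharmonic functions -/
def Subh (g : EuclideanSpace ℂ (Fin n) → ℝ) (Ω : Set (EuclideanSpace ℂ (Fin n))) : Prop :=
  ContinuousOn g Ω ∧ ∀ z ∈ Ω, ∀ φ : EuclideanSpace ℂ (Fin n) → ℝ, ContDiffAt ℝ 2 φ z →
    IsLocalMax (fun x => g x - φ x) z → 0 ≤ lapl φ z

lemma lapl_sub {f g : EuclideanSpace ℂ (Fin n) → ℝ} {z} (hf : ContDiffAt ℝ 2 f z)
    (hg : ContDiffAt ℝ 2 g z) : lapl (fun x => f x - g x) z = lapl f z - lapl g z := by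
  have h := lapl_add hf ((contDiffAt_const (c := (-1:ℝ))).mul hg)
  rw [lapl_const_mul hg] at h
  have e : (fun x => f x - g x) = fun x => f x + (-1) * g x := by ext x; ring
  rw [e, h]; ring

lemma subh_test {g φ : EuclideanSpace ℂ (Fin n) → ℝ} {z} (hg : ContDiffAt ℝ 2 g z)
    (hl : 0 ≤ lapl g z) (hφ : ContDiffAt ℝ 2 φ z) (hm : IsLocalMax (fun x => g x - φ x) z) :
    0 ≤ lapl φ z := by
  have := lapl_nonpos_of_localMax (hg.sub hφ) hm
  have h2 := lapl_sub hg hφ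
  have h3 : lapl (g - φ) z = lapl (fun x => g x - φ x) z := rfl
  linarith

lemma subh_of_contDiff {g : EuclideanSpace ℂ (Fin n) → ℝ} {Ω} (hΩ : IsOpen Ω)
    (hg : ContDiffOn ℝ 2 g Ω) (hl : ∀ z ∈ Ω, 0 ≤ lapl g z) : Subh g Ω :=
  ⟨hg.continuousOn, fun z hz _ hφ hm =>
    subh_test (hg.contDiffAt (hΩ.mem_nhds hz)) (hl z hz) hφ hm⟩

lemma comparison (hn : 0 < n) {Ω : Set (EuclideanSpace ℂ (Fin n))}
    {g K : EuclideanSpace ℂ (Fin n) → ℝ} (hg : Subh g Ω)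
    {c : EuclideanSpace ℂ (Fin n)} {r : ℝ} (hb : closedBall c r ⊆ Ω)
    (hKc : ContinuousOn K (closedBall c r)) (hK2 : ContDiffOn ℝ 2 K (ball c r))
    (hKl : ∀ z ∈ ball c r, lapl K z ≤ 0) (hs : ∀ z ∈ sphere c r, g z ≤ K z) :
    ∀ z ∈ closedBall c r, g z ≤ K z := by
  intro z1 hz1
  by_contra hlt
  push Not at hlt
  set δ := g z1 - K z1 with hδ
  have hδ0 : 0 < δ := by linarith
  set ε := δ / (2 * (r ^ 2 + 1)) with hε
  have hε0 : 0 < ε := by positivity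
  have hεr : ε * r ^ 2 < δ := by
    rw [hε, div_mul_eq_mul_div, div_lt_iff₀ (by positivity)]
    nlinarith [sq_nonneg r]
  have hc : ContinuousOn (fun x => g x - (K x - ε * ‖x - c‖ ^ 2)) (closedBall c r) := by
    refine (hg.1.mono hb).sub (hKc.sub ?_)
    exact (continuous_const.mul (contDiff_normsq c).continuous).continuousOn
  obtain ⟨x, hx, hmax⟩ := (isCompact_closedBall c r).exists_isMaxOn ⟨z1, hz1⟩ hc
  have hx1 : δ ≤ g x - (K x - ε * ‖x - c‖ ^ 2) := by
    have : g z1 - (K z1 - ε * ‖z1 - c‖ ^ 2) ≤ _ := hmax hz1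
    have h2 : 0 ≤ ε * ‖z1 - c‖ ^ 2 := by positivity
    simp only at this
    linarith
  have hxb : x ∈ ball c r := by
    rcases (mem_closedBall.1 hx).lt_or_eq with h | h
    · exact h
    · exfalso
      have h1 := hs x h
      have h2 : ‖x - c‖ = r := by rw [← dist_eq_norm]; exact h
      rw [h2] at hx1
      linarith
  have hn1 : ball c r ∈ 𝓝 x := isOpen_ball.mem_nhds hxb
  have hK2x := hK2.contDiffAt hn1
  have hq : ContDiffAt ℝ 2 (fun x => ε * ‖x - c‖ ^ 2) x :=
    contDiffAt_const.mul (contDiff_normsq c).contDiffAt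
  have := hg.2 x (hb hx) (fun x => K x - ε * ‖x - c‖ ^ 2) (hK2x.sub hq)
    (hmax.isLocalMax (mem_of_superset hn1 ball_subset_closedBall))
  rw [lapl_sub hK2x hq, lapl_const_mul (contDiff_normsq c).contDiffAt, lapl_normsq] at this
  have h4 := hKl x hxb
  have h5 : (0:ℝ) < n := by exact_mod_cast hn
  nlinarith [mul_pos hε0 h5]

/-! ### Poisson kernel -/

/-- the unit sphere -/
abbrev Sph (n : ℕ) := sphere (0 : EuclideanSpace ℂ (Fin n)) 1

/-- inner product map -/
noncomputable def ell (n : ℕ) : EuclideanSpace ℂ (Fin n) →L[ℝ] C(Sph n, ℝ) :=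
  LinearMap.toContinuousLinearMap
    { toFun := fun x => ⟨fun ζ => inner ℝ x (ζ : EuclideanSpace ℂ (Fin n)), by fun_prop⟩
      map_add' := fun x y => by ext ζ; simp [inner_add_left]
      map_smul' := fun c x => by ext ζ; simp [inner_smul_left] }

lemma ell_apply (x : EuclideanSpace ℂ (Fin n)) (ζ : Sph n) :
    ell n x ζ = inner ℝ x (ζ : EuclideanSpace ℂ (Fin n)) := rfl

/-- denominator -/
noncomputable def den (x : EuclideanSpace ℂ (Fin n)) : C(Sph n, ℝ) :=
  (‖x‖ ^ 2 + 1) • (1 : C(Sph n, ℝ)) - (2:ℝ) • ell n x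

lemma den_apply (x : EuclideanSpace ℂ (Fin n)) (ζ : Sph n) : den x ζ = ‖x - ζ‖ ^ 2 := by
  have : ‖(ζ : EuclideanSpace ℂ (Fin n))‖ = 1 := by simp
  rw [norm_sub_sq_real, this]
  simp [den, ell_apply]; ring

lemma dist_pos_of {x : EuclideanSpace ℂ (Fin n)} (hx : ‖x‖ < 1) (ζ : Sph n) :
    0 < ‖x - ζ‖ := by
  have : ‖(ζ : EuclideanSpace ℂ (Fin n))‖ = 1 := by simp
  rw [norm_pos_iff, sub_ne_zero]
  rintro rfl
  linarith

lemma den_isUnit {x : EuclideanSpace ℂ (Fin n)} (hx : ‖x‖ < 1) : IsUnit (den x) := by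
  rw [ContinuousMap.isUnit_iff_forall_ne_zero]
  intro ζ
  rw [den_apply]
  have := dist_pos_of hx ζ
  positivity

/-- Poisson kernel -/
noncomputable def PK (x : EuclideanSpace ℂ (Fin n)) : C(Sph n, ℝ) :=
  (1 - ‖x‖ ^ 2) • (Ring.inverse (den x)) ^ n

lemma PK_apply {x : EuclideanSpace ℂ (Fin n)} (hx : ‖x‖ < 1) (ζ : Sph n) :
    PK x ζ = (1 - ‖x‖ ^ 2) * ((‖x - ζ‖ ^ 2)⁻¹) ^ n := by
  have h : Ring.inverse (den x) ζ = (‖x - ζ‖ ^ 2)⁻¹ := by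
    have h1 := congrArg (fun k : C(Sph n, ℝ) => k ζ) (Ring.mul_inverse_cancel _ (den_isUnit hx))
    simp only [ContinuousMap.mul_apply, den_apply, ContinuousMap.one_apply] at h1
    exact eq_inv_of_mul_eq_one_right h1
  simp [PK, h]

lemma PK_pos {x : EuclideanSpace ℂ (Fin n)} (hx : ‖x‖ < 1) (ζ : Sph n) : 0 < PK x ζ := by
  rw [PK_apply hx]
  have := dist_pos_of hx ζ
  have : 0 < 1 - ‖x‖ ^ 2 := by nlinarith [norm_nonneg x]
  positivity

lemma PK_contDiffAt {x : EuclideanSpace ℂ (Fin n)} (hx : ‖x‖ < 1) :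
    ContDiffAt ℝ 2 (PK (n := n)) x := by
  have h0 : ContDiff ℝ 2 (fun x : EuclideanSpace ℂ (Fin n) => ‖x‖ ^ 2) := contDiff_id.norm_sq ℝ
  have h1 : ContDiffAt ℝ 2 (den (n := n)) x := by
    refine ContDiff.contDiffAt ?_
    exact ((h0.add contDiff_const).smul contDiff_const).sub
      ((ell n).contDiff.const_smul (2:ℝ))
  have h2 : ContDiffAt ℝ 2 (fun x => Ring.inverse (den (n := n) x)) x := by
    obtain ⟨u, hu⟩ := den_isUnit hx
    have := contDiffAt_ringInverse ℝ u (n := 2)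
    rw [hu] at this
    exact this.comp x h1
  exact (contDiffAt_const.sub h0.contDiffAt).smul (h2.pow n)

lemma inv_pow_deriv {ρ : ℝ → ℝ} {ρ' t : ℝ} (h : HasDerivAt ρ ρ' t) (h0 : ρ t ≠ 0) (k : ℕ) :
    HasDerivAt (fun t => ((ρ t)⁻¹) ^ k) (-(k * ((ρ t)⁻¹) ^ (k + 1) * ρ')) t := by
  refine ((h.inv h0).pow k).congr_deriv ?_
  rcases k with _ | k
  · simp
  · simp only [Nat.add_sub_cancel, Pi.inv_apply]
    rw [div_eq_mul_inv, ← inv_pow]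
    ring

lemma lapl_PKfun {x ζ : EuclideanSpace ℂ (Fin n)} (hx : 0 < ‖x - ζ‖) (hζ : ‖ζ‖ = 1) :
    lapl (fun x => (1 - ‖x‖ ^ 2) * ((‖x - ζ‖ ^ 2)⁻¹) ^ n) x = 0 := by
  have hC : ContDiffAt ℝ 2 (fun x => (1 - ‖x‖ ^ 2) * ((‖x - ζ‖ ^ 2)⁻¹) ^ n) x := by
    have h0 : ContDiff ℝ 2 (fun x : EuclideanSpace ℂ (Fin n) => ‖x‖ ^ 2) := contDiff_id.norm_sq ℝ
    refine (contDiffAt_const.sub h0.contDiffAt).mul ((ContDiffAt.inv ?_ (by positivity)).pow n)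
    exact (contDiff_normsq ζ).contDiffAt
  set s := (‖x - ζ‖ ^ 2)⁻¹ with hs
  have key : ∀ e, D2 (fun x => (1 - ‖x‖ ^ 2) * ((‖x - ζ‖ ^ 2)⁻¹) ^ n) x e =
      -(2 * ‖e‖ ^ 2) * s ^ n + 2 * (2 * inner ℝ x e * (n * s ^ (n + 1) * (2 * inner ℝ (x - ζ) e)))
      + (1 - ‖x‖ ^ 2) * (n * ((n + 1) * s ^ (n + 2) * (2 * inner ℝ (x - ζ) e) ^ 2)
        - n * s ^ (n + 1) * (2 * ‖e‖ ^ 2)) := by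
    intro e
    have ha := normsq_line_deriv x e
    have ha2 := normsq_line_deriv2 x e
    have hr : ∀ t : ℝ, HasDerivAt (fun t : ℝ => ‖x + t • e - ζ‖ ^ 2)
        (2 * inner ℝ (x - ζ) e + 2 * t * ‖e‖ ^ 2) t := fun t => by
      have := normsq_line_deriv (x - ζ) e t
      simpa only [add_sub_right_comm] using this
    have hr2 := normsq_line_deriv2 (x - ζ) e
    have hne : ∀ᶠ t in 𝓝 (0:ℝ), ‖x + t • e - ζ‖ ^ 2 ≠ 0 := by
      refine (hr 0).continuousAt.eventually_ne ?_
      simp only [zero_smul, add_zero]; positivity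
    refine D2_eq hC (d := fun t => -(2 * inner ℝ x e + 2 * t * ‖e‖ ^ 2) *
        ((‖x + t • e - ζ‖ ^ 2)⁻¹) ^ n + (1 - ‖x + t • e‖ ^ 2) *
        (-(n * ((‖x + t • e - ζ‖ ^ 2)⁻¹) ^ (n + 1) * (2 * inner ℝ (x - ζ) e + 2 * t * ‖e‖ ^ 2))))
        ?_ ?_
    · filter_upwards [hne] with t ht
      exact ((ha t).const_sub 1).mul (inv_pow_deriv (hr t) ht n)
    · have h0 := hne.self_of_nhds
      have := (ha2.neg.mul (inv_pow_deriv (hr 0) h0 n)).add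
        (((ha 0).const_sub 1).mul
          ((((inv_pow_deriv (hr 0) h0 (n + 1)).const_mul (n:ℝ)).mul hr2).neg))
      refine this.congr_deriv ?_
      simp only [zero_smul, add_zero, mul_zero, zero_mul, Pi.neg_apply, Pi.mul_apply, ← hs]
      push_cast
      ring
  simp only [lapl, key, inner_single_one, inner_single_I]
  have e1 : ∀ j : Fin n, ‖(EuclideanSpace.single j (1:ℂ) : EuclideanSpace ℂ (Fin n))‖ = 1 := by simp
  have e2 : ∀ j : Fin n, ‖(EuclideanSpace.single j Complex.I : EuclideanSpace ℂ (Fin n))‖ = 1 := by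
    simp
  simp only [e1, e2]
  have hxy := inner_real_eq x (x - ζ)
  have hyy := inner_real_eq (x - ζ) (x - ζ)
  rw [real_inner_self_eq_norm_sq] at hyy
  have hss : s * ‖x - ζ‖ ^ 2 = 1 := by rw [hs]; field_simp
  have hq : 2 * inner ℝ x (x - ζ) = ‖x‖ ^ 2 + ‖x - ζ‖ ^ 2 - 1 := by
    rw [norm_sub_sq_real, inner_sub_right, hζ, real_inner_self_eq_norm_sq]; ring
  have e3 : ∀ j : Fin n,
      (-(2 * 1 ^ 2) * s ^ n + 2 * (2 * (x j).re * (n * s ^ (n + 1) * (2 * ((x - ζ) j).re)))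
      + (1 - ‖x‖ ^ 2) * (n * ((n + 1) * s ^ (n + 2) * (2 * ((x - ζ) j).re) ^ 2)
        - n * s ^ (n + 1) * (2 * 1 ^ 2)) +
      (-(2 * 1 ^ 2) * s ^ n + 2 * (2 * (x j).im * (n * s ^ (n + 1) * (2 * ((x - ζ) j).im)))
      + (1 - ‖x‖ ^ 2) * (n * ((n + 1) * s ^ (n + 2) * (2 * ((x - ζ) j).im) ^ 2)
        - n * s ^ (n + 1) * (2 * 1 ^ 2)))) =
      (-4 * s ^ n - (1 - ‖x‖ ^ 2) * (4 * n * s ^ (n + 1)))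
      + 8 * n * s ^ (n + 1) * ((x j).re * ((x - ζ) j).re + (x j).im * ((x - ζ) j).im)
      + (1 - ‖x‖ ^ 2) * (4 * n * (n + 1) * s ^ (n + 2)) *
        (((x - ζ) j).re * ((x - ζ) j).re + ((x - ζ) j).im * ((x - ζ) j).im) := by
    intro j; ring
  rw [Finset.sum_congr rfl fun j _ => e3 j, Finset.sum_add_distrib, Finset.sum_add_distrib,
    ← Finset.mul_sum, ← Finset.mul_sum, ← hxy, ← hyy]
  simp only [Finset.sum_const, Finset.card_univ, Fintype.card_fin, nsmul_eq_mul]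
  have h6 : inner ℝ x (x - ζ) = (‖x‖ ^ 2 + ‖x - ζ‖ ^ 2 - 1) / 2 := by linarith
  rw [h6]
  generalize ‖x - ζ‖ ^ 2 = y at *
  generalize ‖x‖ ^ 2 = a at *
  have h7 : s ^ (n + 1) * y = s ^ n := by rw [pow_succ, mul_assoc, hss, mul_one]
  have h8 : s ^ (n + 2) * y = s ^ (n + 1) := by rw [pow_succ, mul_assoc, hss, mul_one]
  linear_combination (4 * n : ℝ) * h7 + (1 - a) * (4 * n * (n + 1)) * h8

lemma lapl_PK {x : EuclideanSpace ℂ (Fin n)} (hx : ‖x‖ < 1) : lapl (PK (n := n)) x = 0 := by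
  ext ζ
  have h := lapl_clm (PK_contDiffAt hx) (ContinuousMap.evalCLM ℝ ζ : C(Sph n, ℝ) →L[ℝ] ℝ)
  have hζ : ‖(ζ : EuclideanSpace ℂ (Fin n))‖ = 1 := by simp
  have h2 : (fun x => (ContinuousMap.evalCLM ℝ ζ : C(Sph n, ℝ) →L[ℝ] ℝ) (PK (n := n) x)) =ᶠ[𝓝 x]
      (fun x => (1 - ‖x‖ ^ 2) * ((‖x - ζ‖ ^ 2)⁻¹) ^ n) := by
    have : ∀ᶠ y in 𝓝 x, ‖y‖ < 1 := continuous_norm.continuousAt.eventually_lt_const hx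
    filter_upwards [this] with y hy
    exact PK_apply hy ζ
  rw [lapl_congr h2, lapl_PKfun (dist_pos_of hx ζ) hζ] at h
  exact h.symm

end Part2


section Part3
open Filter Topology Metric
open scoped Pointwise

variable {n : ℕ}

/-- surface measure -/
noncomputable def sig0 (n : ℕ) : Measure (Sph n) :=
  (volume : Measure (EuclideanSpace ℂ (Fin n))).toSphere

/-- normalized surface measure -/
noncomputable def sig (n : ℕ) : Measure (Sph n) := (sig0 n univ)⁻¹ • sig0 n

instance : IsFiniteMeasure (sig0 n) := by unfold sig0; infer_instance

lemma sig_prob (hn : 0 < n) : IsProbabilityMeasure (sig n) := by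
  have : Nonempty (Fin n) := ⟨⟨0, hn⟩⟩
  have : Nontrivial (EuclideanSpace ℂ (Fin n)) := inferInstance
  have : NeZero (sig0 n) := ⟨Measure.toSphere_ne_zero _⟩
  unfold sig
  infer_instance

/-- rotation of the sphere -/
noncomputable def rotS (T : EuclideanSpace ℂ (Fin n) ≃ₗᵢ[ℝ] EuclideanSpace ℂ (Fin n)) (ζ : Sph n) : Sph n :=
  ⟨T ζ, by simp⟩

lemma rotS_cont (T : EuclideanSpace ℂ (Fin n) ≃ₗᵢ[ℝ] EuclideanSpace ℂ (Fin n)) :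
    Continuous (rotS T) := by
  unfold rotS
  exact Continuous.subtype_mk (T.continuous.comp continuous_subtype_val) _

lemma sig0_map (T : EuclideanSpace ℂ (Fin n) ≃ₗᵢ[ℝ] EuclideanSpace ℂ (Fin n)) :
    (sig0 n).map (rotS T) = sig0 n := by
  ext s hs
  have hm := (rotS_cont T).measurable
  rw [Measure.map_apply hm hs]
  unfold sig0
  rw [Measure.toSphere_apply' _ (hm hs), Measure.toSphere_apply' _ hs]
  congr 1
  have h1 : (Ioo (0:ℝ) 1 • (Subtype.val '' (rotS T ⁻¹' s)) : Set (EuclideanSpace ℂ (Fin n))) =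
      T ⁻¹' (Ioo (0:ℝ) 1 • (Subtype.val '' s)) := by
    ext x
    simp only [Set.mem_smul, mem_image, mem_preimage]
    constructor
    · rintro ⟨a, ha, y, ⟨ζ, hζ, rfl⟩, rfl⟩
      exact ⟨a, ha, _, ⟨_, hζ, rfl⟩, by simp [rotS]⟩
    · rintro ⟨a, ha, y, ⟨ζ, hζ, rfl⟩, h⟩
      refine ⟨a, ha, T.symm ζ, ⟨⟨T.symm ζ, by simp⟩, ?_, rfl⟩, ?_⟩
      · simpa [rotS] using hζ
      · apply T.injective; simp [h]
  rw [h1]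
  exact (T.measurePreserving).measure_preimage_emb T.toHomeomorph.measurableEmbedding _

lemma sig_map (T : EuclideanSpace ℂ (Fin n) ≃ₗᵢ[ℝ] EuclideanSpace ℂ (Fin n)) :
    (sig n).map (rotS T) = sig n := by
  rw [sig, Measure.map_smul, sig0_map]

/-- Poisson integral -/
noncomputable def PI (φ : Sph n → ℝ) (x : EuclideanSpace ℂ (Fin n)) : ℝ :=
  ∫ ζ, PK x ζ * φ ζ ∂(sig n)

lemma PI_integrable (hn : 0 < n) {φ : Sph n → ℝ} (hφ : Measurable φ) {M : ℝ}
    (hM : ∀ ζ, |φ ζ| ≤ M) (k : C(Sph n, ℝ)) :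
    Integrable (fun ζ => k ζ * φ ζ) (sig n) := by
  have := sig_prob hn
  refine Integrable.of_bound (k.continuous.measurable.mul hφ).aestronglyMeasurable (‖k‖ * M)
    (Eventually.of_forall fun ζ => ?_)
  rw [norm_mul]
  exact mul_le_mul (k.norm_coe_le_norm ζ) (hM ζ) (norm_nonneg _) (norm_nonneg _)

/-- integration against φ as a functional -/
lemma exists_functional (hn : 0 < n) {φ : Sph n → ℝ} (hφ : Measurable φ) {M : ℝ}
    (hM : ∀ ζ, |φ ζ| ≤ M) :
    ∃ L : C(Sph n, ℝ) →L[ℝ] ℝ, ∀ k, L k = ∫ ζ, k ζ * φ ζ ∂(sig n) := by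
  have := sig_prob hn
  refine ⟨LinearMap.mkContinuous
    { toFun := fun k => ∫ ζ, k ζ * φ ζ ∂(sig n)
      map_add' := fun a b => ?_
      map_smul' := fun c a => ?_ } M ?_, fun k => rfl⟩
  · rw [← integral_add (PI_integrable hn hφ hM a) (PI_integrable hn hφ hM b)]
    simp [add_mul]
  · simp [mul_assoc, integral_const_mul]
  · intro k
    have : ∀ ζ, ‖k ζ * φ ζ‖ ≤ M * ‖k‖ := fun ζ => by
      rw [norm_mul, mul_comm]
      exact mul_le_mul (hM ζ) (k.norm_coe_le_norm ζ) (norm_nonneg _) ((abs_nonneg _).trans (hM ζ))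
    have h2 := norm_integral_le_of_norm_le_const (μ := sig n) (Eventually.of_forall this)
    simpa using h2

lemma PI_contDiffAt (hn : 0 < n) {φ : Sph n → ℝ} (hφ : Measurable φ) {M : ℝ}
    (hM : ∀ ζ, |φ ζ| ≤ M) {x : EuclideanSpace ℂ (Fin n)} (hx : ‖x‖ < 1) :
    ContDiffAt ℝ 2 (PI φ) x ∧ lapl (PI φ) x = 0 := by
  obtain ⟨L, hL⟩ := exists_functional hn hφ hM
  have h : PI φ = fun x => L (PK x) := by ext x; rw [hL]; rfl
  rw [h]
  refine ⟨L.contDiff.contDiffAt.comp x (PK_contDiffAt hx), ?_⟩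
  rw [lapl_clm (PK_contDiffAt hx), lapl_PK hx, map_zero]

lemma PI_one (hn : 0 < n) {x : EuclideanSpace ℂ (Fin n)} (hx : ‖x‖ < 1) :
    ∫ ζ, PK x ζ ∂(sig n) = 1 := by
  have := sig_prob hn
  set J : EuclideanSpace ℂ (Fin n) → ℝ := fun x => ∫ ζ, PK x ζ ∂(sig n) with hJ
  have hJ1 : J = PI (fun _ => 1) := by ext x; simp [hJ, PI]
  have hreg : ∀ x ∈ ball (0 : EuclideanSpace ℂ (Fin n)) 1, ContDiffAt ℝ 2 J x ∧ lapl J x = 0 := by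
    intro x hx
    rw [hJ1]
    exact PI_contDiffAt hn measurable_const (M := 1) (by simp) (by simpa using hx)
  have hrot : ∀ T : EuclideanSpace ℂ (Fin n) ≃ₗᵢ[ℝ] EuclideanSpace ℂ (Fin n), ∀ x, ‖x‖ < 1 →
      J (T x) = J x := by
    intro T x hx
    have h1 : ∫ ζ, PK (T x) ζ ∂(sig n) = ∫ ζ, PK (T x) ζ ∂((sig n).map (rotS T)) := by rw [sig_map]
    simp only [hJ]
    rw [h1, integral_map (rotS_cont T).measurable.aemeasurable
      (PK (T x)).continuous.measurable.aestronglyMeasurable]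
    refine integral_congr_ae (Eventually.of_forall fun ζ => ?_)
    simp only
    rw [PK_apply (by simpa using hx), PK_apply hx]
    simp only [rotS, ← map_sub, LinearIsometryEquiv.norm_map]
  have hrad : ∀ x y : EuclideanSpace ℂ (Fin n), ‖x‖ = ‖y‖ → ‖x‖ < 1 → J y = J x := by
    intro x y hxy hx
    rw [← Submodule.reflection_sub hxy]
    exact hrot _ x hx
  have hC : ContDiffOn ℝ 2 J (ball 0 1) := fun x hx => (hreg x hx).1.contDiffWithinAt
  have hC' : ContDiffOn ℝ 2 (fun x => (-1) * J x) (ball 0 1) := contDiffOn_const.mul hC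
  have hsub : closedBall (0 : EuclideanSpace ℂ (Fin n)) ‖x‖ ⊆ ball 0 1 :=
    closedBall_subset_ball hx
  have hS1 : Subh J (ball 0 1) := subh_of_contDiff isOpen_ball hC fun z hz => (hreg z hz).2.ge
  have hS2 : Subh (fun x => (-1) * J x) (ball 0 1) := subh_of_contDiff isOpen_ball hC' fun z hz => by
    rw [lapl_const_mul (hreg z hz).1, (hreg z hz).2]; simp
  have h0 : (0 : EuclideanSpace ℂ (Fin n)) ∈ closedBall (0 : EuclideanSpace ℂ (Fin n)) ‖x‖ := by simp
  have hsph : ∀ z ∈ sphere (0 : EuclideanSpace ℂ (Fin n)) ‖x‖, J z = J x := fun z hz =>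
    hrad x z (by simpa using hz.symm) hx
  have c1 := comparison hn hS1 hsub (K := fun _ => J x) continuousOn_const contDiffOn_const
    (fun z _ => (lapl_const _ z).le) (fun z hz => (hsph z hz).le) 0 h0
  have c2 := comparison hn hS2 hsub (K := fun _ => (-1) * J x) continuousOn_const contDiffOn_const
    (fun z _ => (lapl_const _ z).le) (fun z hz => by rw [hsph z hz]) 0 h0
  have h00 : J 0 = 1 := by
    simp only [hJ]
    have : ∀ ζ, PK (0 : EuclideanSpace ℂ (Fin n)) ζ = 1 := fun ζ => by
      rw [PK_apply (by simp)]
      simp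
    simp [this]
  change J x = 1
  linarith

lemma PI_boundary (hn : 0 < n) {φ : Sph n → ℝ} (hφ : Continuous φ) (ζ₀ : Sph n) {ε : ℝ}
    (hε : 0 < ε) : ∃ δ > 0, ∀ x : EuclideanSpace ℂ (Fin n), ‖x‖ < 1 → ‖x - ζ₀‖ < δ →
      |PI φ x - φ ζ₀| < ε := by
  have := sig_prob hn
  obtain ⟨M, hM⟩ : ∃ M, ∀ ζ, |φ ζ| ≤ M := by
    obtain ⟨M, hM⟩ := (isCompact_range hφ).isBounded.exists_norm_le
    exact ⟨M, fun ζ => hM _ ⟨ζ, rfl⟩⟩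
  have hM0 : 0 ≤ M := (abs_nonneg _).trans (hM ζ₀)
  obtain ⟨d, hd, hdφ⟩ := Metric.continuous_iff.1 hφ ζ₀ (ε / 2) (by positivity)
  set C : ℝ := (((d / 2) ^ 2)⁻¹) ^ n with hC
  have hC0 : 0 < C := by positivity
  refine ⟨min (d / 2) (ε / (2 * (4 * (M + 1) * C))), by positivity, fun x hx hxζ => ?_⟩
  have hx1 := lt_of_lt_of_le hxζ (min_le_left _ _)
  have hx2 := lt_of_lt_of_le hxζ (min_le_right _ _)
  rw [lt_div_iff₀ (by positivity)] at hx2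
  have hζ0 : ‖(ζ₀ : EuclideanSpace ℂ (Fin n))‖ = 1 := by simp
  have hx3 : 1 - ‖x‖ ≤ ‖x - ζ₀‖ := by
    have := norm_sub_norm_le (ζ₀ : EuclideanSpace ℂ (Fin n)) x
    rw [norm_sub_rev, hζ0] at this; exact this
  have hx4 : 1 - ‖x‖ ^ 2 ≤ 2 * ‖x - ζ₀‖ := by nlinarith [norm_nonneg x]
  have hx5 : 0 ≤ 1 - ‖x‖ ^ 2 := by nlinarith [norm_nonneg x]
  have i1 := PI_integrable hn hφ.measurable hM (PK x)
  have i0 : Integrable (fun ζ => PK x ζ) (sig n) := by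
    simpa using PI_integrable hn (φ := fun _ => 1) measurable_const (M := 1) (by simp) (PK x)
  have e1 : PI φ x - φ ζ₀ = ∫ ζ, PK x ζ * (φ ζ - φ ζ₀) ∂(sig n) := by
    simp only [mul_sub]
    rw [integral_sub i1 (i0.mul_const _), integral_mul_const, PI_one hn hx, one_mul]
    rfl
  have hpt : ∀ ζ, ‖PK x ζ * (φ ζ - φ ζ₀)‖ ≤ PK x ζ * (ε / 2) + 2 * M * ((1 - ‖x‖ ^ 2) * C) := by
    intro ζ
    have hp := PK_pos hx ζ
    rw [norm_mul, Real.norm_of_nonneg hp.le]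
    by_cases hζ : dist ζ ζ₀ < d
    · have h1 := (hdφ ζ hζ).le
      rw [Real.dist_eq] at h1
      have : 0 ≤ 2 * M * ((1 - ‖x‖ ^ 2) * C) := by positivity
      have := mul_le_mul_of_nonneg_left h1 hp.le
      rw [Real.norm_eq_abs]
      linarith
    · push Not at hζ
      have h1 : d / 2 ≤ ‖x - ζ‖ := by
        have h2 : dist ζ ζ₀ ≤ ‖x - ζ‖ + ‖x - ζ₀‖ := by
          rw [Subtype.dist_eq, dist_eq_norm]
          calc ‖(ζ : EuclideanSpace ℂ (Fin n)) - ζ₀‖ = ‖(x - ζ₀) - (x - ζ)‖ := by congr 1; abel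
            _ ≤ ‖x - ζ₀‖ + ‖x - ζ‖ := norm_sub_le _ _
            _ = _ := add_comm _ _
        linarith
      have h2 : PK x ζ ≤ (1 - ‖x‖ ^ 2) * C := by
        rw [PK_apply hx]
        rw [hC]
        gcongr
      have h3 : ‖φ ζ - φ ζ₀‖ ≤ 2 * M := by
        have := norm_sub_le (φ ζ) (φ ζ₀)
        have a := hM ζ
        have b := hM ζ₀
        simp only [Real.norm_eq_abs] at this ⊢
        linarith
      have h4 : 0 ≤ PK x ζ * (ε / 2) := by positivity
      have h5 := mul_le_mul h2 h3 (norm_nonneg _) (by positivity)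
      linarith
  have i2 : Integrable (fun ζ => PK x ζ * (ε / 2) + 2 * M * ((1 - ‖x‖ ^ 2) * C)) (sig n) :=
    (i0.mul_const _).add (integrable_const _)
  have := norm_integral_le_of_norm_le i2 (Eventually.of_forall hpt)
  rw [integral_add (i0.mul_const _) (integrable_const _), integral_mul_const, PI_one hn hx] at this
  simp only [integral_const, probReal_univ, smul_eq_mul, one_mul] at this
  rw [e1, ← Real.norm_eq_abs]
  have h6 : 2 * M * ((1 - ‖x‖ ^ 2) * C) ≤ 2 * M * (2 * ‖x - ζ₀‖ * C) := by gcongr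
  have h7 : 2 * M * (2 * ‖x - ζ₀‖ * C) ≤ (‖x - ζ₀‖ * (2 * (4 * (M + 1) * C))) / 2 := by
    have : 0 ≤ ‖x - ζ₀‖ * C := by positivity
    nlinarith
  linarith

end Part3


section Part4
open Filter Topology Metric

variable {n : ℕ}

open scoped Classical in
/-- Poisson modification -/
noncomputable def modif (g : EuclideanSpace ℂ (Fin n) → ℝ) (c : EuclideanSpace ℂ (Fin n)) (r : ℝ)
    (z : EuclideanSpace ℂ (Fin n)) : ℝ :=
  if z ∈ ball c r then PI (fun ζ : Sph n => g (c + r • (ζ : EuclideanSpace ℂ (Fin n)))) (r⁻¹ • (z - c))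
  else g z

lemma modif_in {g : EuclideanSpace ℂ (Fin n) → ℝ} {c r z} (h : z ∈ ball c r) :
    modif g c r z = PI (fun ζ : Sph n => g (c + r • (ζ : EuclideanSpace ℂ (Fin n)))) (r⁻¹ • (z - c)) :=
  if_pos h

lemma modif_out {g : EuclideanSpace ℂ (Fin n) → ℝ} {c r z} (h : z ∉ ball c r) :
    modif g c r z = g z := if_neg h

lemma scale_lt {c z : EuclideanSpace ℂ (Fin n)} {r : ℝ} (hr : 0 < r) (hz : z ∈ ball c r) :
    ‖r⁻¹ • (z - c)‖ < 1 := by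
  rw [mem_ball, dist_eq_norm] at hz
  rw [norm_smul, norm_inv, Real.norm_of_nonneg hr.le, inv_mul_lt_iff₀ hr]
  linarith

lemma PI_affine (hn : 0 < n) {φ : Sph n → ℝ} (hφ : Measurable φ) {M : ℝ}
    (hM : ∀ ζ, |φ ζ| ≤ M) {c : EuclideanSpace ℂ (Fin n)} {r : ℝ} (hr : 0 < r)
    {x : EuclideanSpace ℂ (Fin n)} (hx : x ∈ ball c r) :
    ContDiffAt ℝ 2 (fun x => PI φ (r⁻¹ • (x - c))) x ∧
      lapl (fun x => PI φ (r⁻¹ • (x - c))) x = 0 := by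
  obtain ⟨h1, h2⟩ := PI_contDiffAt hn hφ hM (scale_lt hr hx)
  constructor
  · refine ContDiffAt.comp (g := PI φ) (f := fun x => r⁻¹ • (x - c)) x h1 ?_
    exact ((contDiff_id.sub contDiff_const).const_smul r⁻¹).contDiffAt
  · rw [lapl_affine c r⁻¹ h1, h2, smul_zero]

lemma sph_mem {c : EuclideanSpace ℂ (Fin n)} {r : ℝ} (hr : 0 < r) (ζ : Sph n) :
    c + r • (ζ : EuclideanSpace ℂ (Fin n)) ∈ sphere c r := by
  simp [norm_smul, abs_of_pos hr]

lemma phi_cont {g : EuclideanSpace ℂ (Fin n) → ℝ} {Ω} (hg : ContinuousOn g Ω)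
    {c : EuclideanSpace ℂ (Fin n)} {r : ℝ} (hr : 0 < r) (hb : closedBall c r ⊆ Ω) :
    Continuous (fun ζ : Sph n => g (c + r • (ζ : EuclideanSpace ℂ (Fin n)))) := by
  refine hg.comp_continuous (by fun_prop) fun ζ => hb (sphere_subset_closedBall (sph_mem hr ζ))

lemma phi_bdd {φ : Sph n → ℝ} (hφ : Continuous φ) : ∃ M, ∀ ζ, |φ ζ| ≤ M := by
  obtain ⟨M, hM⟩ := (isCompact_range hφ).isBounded.exists_norm_le
  exact ⟨M, fun ζ => hM _ ⟨ζ, rfl⟩⟩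

lemma modif_continuousOn (hn : 0 < n) {g : EuclideanSpace ℂ (Fin n) → ℝ} {Ω}
    (hg : ContinuousOn g Ω) {c : EuclideanSpace ℂ (Fin n)} {r : ℝ} (hr : 0 < r)
    (hb : closedBall c r ⊆ Ω) : ContinuousOn (modif g c r) Ω := by
  have hφ := phi_cont hg hr hb
  obtain ⟨M, hM⟩ := phi_bdd hφ
  intro z hz
  by_cases hzb : z ∈ ball c r
  · have h1 := (PI_affine hn hφ.measurable hM hr hzb).1.continuousAt
    refine (h1.congr ?_).continuousWithinAt
    filter_upwards [isOpen_ball.mem_nhds hzb] with x hx using (modif_in hx).symm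
  by_cases hzc : z ∈ closedBall c r
  · have hzs : dist z c = r := le_antisymm hzc (not_lt.1 hzb)
    rw [Metric.continuousWithinAt_iff]
    intro ε hε
    have hne : ‖z - c‖ = r := by rw [← dist_eq_norm]; exact hzs
    obtain ⟨δ, hδ, h1⟩ := PI_boundary hn hφ ⟨r⁻¹ • (z - c), by
      rw [mem_sphere_zero_iff_norm, norm_smul, norm_inv, Real.norm_of_nonneg hr.le, hne]
      field_simp⟩ hε
    obtain ⟨δ', hδ', h2⟩ := Metric.continuousWithinAt_iff.1 (hg z hz) ε hε
    have hback : c + r • (r⁻¹ • (z - c)) = z := by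
      rw [smul_smul, mul_inv_cancel₀ hr.ne', one_smul]; abel
    refine ⟨min (r * δ) δ', by positivity, fun {x} hx hxz => ?_⟩
    rw [modif_out hzb]
    by_cases hxb : x ∈ ball c r
    · rw [modif_in hxb]
      have := h1 (r⁻¹ • (x - c)) (scale_lt hr hxb) (by
        have h3 := lt_of_lt_of_le hxz (min_le_left _ _)
        simp only
        rw [← smul_sub, norm_smul, norm_inv, Real.norm_of_nonneg hr.le, inv_mul_lt_iff₀ hr]
        rw [dist_eq_norm] at h3
        simpa using h3)
      simp only [hback] at this
      rw [Real.dist_eq]; exact this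
    · rw [modif_out hxb]
      exact h2 hx (lt_of_lt_of_le hxz (min_le_right _ _))
  · refine (hg z hz).congr_of_eventuallyEq ?_ (modif_out hzb)
    refine mem_nhdsWithin_of_mem_nhds ?_
    filter_upwards [isClosed_closedBall.isOpen_compl.mem_nhds hzc] with x hx
    exact modif_out fun h => hx (ball_subset_closedBall h)

lemma modif_ball_reg (hn : 0 < n) {g : EuclideanSpace ℂ (Fin n) → ℝ} {Ω}
    (hg : ContinuousOn g Ω) {c : EuclideanSpace ℂ (Fin n)} {r : ℝ} (hr : 0 < r)
    (hb : closedBall c r ⊆ Ω) {z} (hz : z ∈ ball c r) :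
    ContDiffAt ℝ 2 (modif g c r) z ∧ lapl (modif g c r) z = 0 := by
  have hφ := phi_cont hg hr hb
  obtain ⟨M, hM⟩ := phi_bdd hφ
  obtain ⟨h1, h2⟩ := PI_affine hn hφ.measurable hM hr hz
  have h3 : modif g c r =ᶠ[𝓝 z]
      (fun x => PI (fun ζ : Sph n => g (c + r • (ζ : EuclideanSpace ℂ (Fin n)))) (r⁻¹ • (x - c))) := by
    filter_upwards [isOpen_ball.mem_nhds hz] with x hx using modif_in hx
  exact ⟨h1.congr_of_eventuallyEq h3, (lapl_congr h3).trans h2⟩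

lemma modif_spec (hn : 0 < n) {g : EuclideanSpace ℂ (Fin n) → ℝ} {Ω}
    (hg : Subh g Ω) {c : EuclideanSpace ℂ (Fin n)} {r : ℝ} (hr : 0 < r)
    (hb : closedBall c r ⊆ Ω) : Subh (modif g c r) Ω ∧ ∀ z, g z ≤ modif g c r z := by
  have hreg := fun z (hz : z ∈ ball c r) => modif_ball_reg hn hg.1 hr hb hz
  have hc := modif_continuousOn hn hg.1 hr hb
  have hle : ∀ z, g z ≤ modif g c r z := by
    intro z
    by_cases hz : z ∈ ball c r
    · refine comparison hn hg hb (hc.mono hb) (fun x hx => (hreg x hx).1.contDiffWithinAt)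
        (fun x hx => (hreg x hx).2.le) (fun x hx => ?_) z (ball_subset_closedBall hz)
      refine (modif_out ?_).ge
      rw [mem_ball, mem_sphere.1 hx]; exact lt_irrefl _
    · exact (modif_out hz).ge
  refine ⟨⟨hc, fun z hz φ hφ hm => ?_⟩, hle⟩
  by_cases hzb : z ∈ ball c r
  · exact subh_test (hreg z hzb).1 (hreg z hzb).2.ge hφ hm
  · refine hg.2 z hz φ hφ ?_
    filter_upwards [hm] with x hx
    have h1 := hle x
    rw [modif_out hzb] at hx
    linarith

lemma modif_le (hn : 0 < n) {g W : EuclideanSpace ℂ (Fin n) → ℝ} {Ω}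
    (hg : Subh g Ω) {c : EuclideanSpace ℂ (Fin n)} {r : ℝ} (hr : 0 < r)
    (hb : closedBall c r ⊆ Ω) (hW : ContDiffOn ℝ 2 W Ω) (hWl : ∀ z ∈ Ω, lapl W z ≤ 0)
    (hgW : ∀ z ∈ Ω, g z ≤ W z) : ∀ z ∈ Ω, modif g c r z ≤ W z := by
  intro z hz
  by_cases hzb : z ∈ ball c r
  · refine comparison hn (modif_spec hn hg hr hb).1 hb (hW.continuousOn.mono hb)
      (hW.mono (ball_subset_closedBall.trans hb))
      (fun x hx => hWl x (hb (ball_subset_closedBall hx))) (fun x hx => ?_) z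
      (ball_subset_closedBall hzb)
    rw [modif_out]
    · exact hgW x (hb (sphere_subset_closedBall hx))
    · rw [mem_ball, mem_sphere.1 hx]; exact lt_irrefl _
  · rw [modif_out hzb]; exact hgW z hz

open scoped Classical in
/-- sweeping sequence -/
noncomputable def sweep (Ω : Set (EuclideanSpace ℂ (Fin n))) (g : EuclideanSpace ℂ (Fin n) → ℝ)
    (c : ℕ → EuclideanSpace ℂ (Fin n)) (r : ℕ → ℝ) : ℕ → EuclideanSpace ℂ (Fin n) → ℝ
  | 0 => g
  | k + 1 => if closedBall (c (Nat.unpair k).1) (r (Nat.unpair k).1) ⊆ Ω then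
      modif (sweep Ω g c r k) (c (Nat.unpair k).1) (r (Nat.unpair k).1) else sweep Ω g c r k

theorem sandwich_pos (hn : 0 < n) {g W : EuclideanSpace ℂ (Fin n) → ℝ}
    {Ω : Set (EuclideanSpace ℂ (Fin n))} (hΩ : IsOpen Ω)
    (hg : Subh g Ω) (hW : ContDiffOn ℝ 2 W Ω) (hWl : ∀ z ∈ Ω, lapl W z ≤ 0)
    (hgW : ∀ z ∈ Ω, g z ≤ W z) :
    ∃ h, HarmonicOnCn h Ω ∧ ∀ z ∈ Ω, g z ≤ h z ∧ h z ≤ W z := by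
  classical
  set c : ℕ → EuclideanSpace ℂ (Fin n) := fun a =>
    TopologicalSpace.denseSeq (EuclideanSpace ℂ (Fin n)) (Nat.unpair a).1 with hc
  set r : ℕ → ℝ := fun a => 1 / (((Nat.unpair a).2 : ℝ) + 1) with hr
  have hr0 : ∀ a, 0 < r a := fun a => by positivity
  have hcover : ∀ z ∈ Ω, ∃ a, closedBall (c a) (r a) ⊆ Ω ∧ z ∈ ball (c a) (r a) := by
    intro z hz
    obtain ⟨ε, hε, hεΩ⟩ := Metric.isOpen_iff.1 hΩ z hz
    obtain ⟨m, hm⟩ := exists_nat_one_div_lt (show (0:ℝ) < ε / 2 by positivity)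
    have hm0 : (0:ℝ) < 1 / ((m:ℝ) + 1) := by positivity
    obtain ⟨i, hi⟩ := (TopologicalSpace.denseRange_denseSeq (EuclideanSpace ℂ (Fin n))).exists_dist_lt z hm0
    refine ⟨Nat.pair i m, ?_, ?_⟩
    · simp only [hc, hr, Nat.unpair_pair]
      intro x hx
      apply hεΩ
      rw [mem_closedBall] at hx
      rw [mem_ball]
      have := dist_triangle_right x z (TopologicalSpace.denseSeq (EuclideanSpace ℂ (Fin n)) i)
      linarith
    · simp only [hc, hr, Nat.unpair_pair]
      exact hi
  set G := sweep Ω g c r with hG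
  have hinv : ∀ k, Subh (G k) Ω ∧ (∀ z ∈ Ω, G k z ≤ W z) := by
    intro k
    induction k with
    | zero => exact ⟨hg, hgW⟩
    | succ k ih =>
      simp only [hG, sweep]
      split_ifs with h
      · exact ⟨(modif_spec hn ih.1 (hr0 _) h).1, modif_le hn ih.1 (hr0 _) h hW hWl ih.2⟩
      · exact ih
  have hmono : ∀ z, Monotone (fun k => G k z) := by
    intro z
    refine monotone_nat_of_le_succ fun k => ?_
    simp only [hG, sweep]
    split_ifs with h
    · exact (modif_spec hn (hinv k).1 (hr0 _) h).2 z
    · exact le_rfl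
  have hbdd : ∀ z ∈ Ω, BddAbove (range fun k => G k z) := by
    rintro z hz
    exact ⟨W z, by rintro _ ⟨k, rfl⟩; exact (hinv k).2 z hz⟩
  set h : EuclideanSpace ℂ (Fin n) → ℝ := fun z => ⨆ k, G k z with hh
  have hlim : ∀ z ∈ Ω, Tendsto (fun k => G k z) atTop (𝓝 (h z)) := fun z hz =>
    tendsto_atTop_ciSup (hmono z) (hbdd z hz)
  have hgh : ∀ z ∈ Ω, g z ≤ h z := fun z hz => le_ciSup (hbdd z hz) 0
  have hhW : ∀ z ∈ Ω, h z ≤ W z := fun z hz => ciSup_le fun k => (hinv k).2 z hz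
  have hloc : ∀ z ∈ Ω, ContDiffAt ℝ 2 h z ∧ lapl h z = 0 := by
    intro z hz
    obtain ⟨a, ha, hza⟩ := hcover z hz
    have hsub : ∀ ζ : Sph n, c a + r a • (ζ : EuclideanSpace ℂ (Fin n)) ∈ Ω := fun ζ =>
      ha (sphere_subset_closedBall (sph_mem (hr0 a) ζ))
    set φ : Sph n → ℝ := fun ζ => h (c a + r a • (ζ : EuclideanSpace ℂ (Fin n))) with hφ
    set ψ : ℕ → Sph n → ℝ := fun b ζ => G (Nat.pair a b) (c a + r a • (ζ : EuclideanSpace ℂ (Fin n)))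
      with hψ
    have hψc : ∀ b, Continuous (ψ b) := fun b => phi_cont (hinv _).1.1 (hr0 a) ha
    have hpair : Tendsto (fun b => Nat.pair a b) atTop atTop :=
      tendsto_atTop_mono (fun b => Nat.right_le_pair a b) tendsto_id
    have hψl : ∀ ζ, Tendsto (fun b => ψ b ζ) atTop (𝓝 (φ ζ)) := fun ζ =>
      (hlim _ (hsub ζ)).comp hpair
    have hφm : Measurable φ := measurable_of_tendsto_metrizable (fun b => (hψc b).measurable)
      (tendsto_pi_nhds.2 hψl)
    obtain ⟨M1, hM1⟩ := phi_bdd (phi_cont hg.1 (hr0 a) ha)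
    obtain ⟨M2, hM2⟩ := phi_bdd (phi_cont hW.continuousOn (hr0 a) ha)
    have hψM : ∀ b ζ, |ψ b ζ| ≤ max M1 M2 := by
      intro b ζ
      have h1 : g _ ≤ ψ b ζ := hmono (c a + r a • (ζ : EuclideanSpace ℂ (Fin n))) (Nat.zero_le (Nat.pair a b))
      have h2 : ψ b ζ ≤ W _ := (hinv (Nat.pair a b)).2 _ (hsub ζ)
      have h3 := abs_le.1 (hM1 ζ)
      have h4 := abs_le.1 (hM2 ζ)
      rw [abs_le]
      constructor
      · linarith [le_max_left M1 M2]
      · linarith [le_max_right M1 M2]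
    have hφM : ∀ ζ, |φ ζ| ≤ max M1 M2 := fun ζ =>
      le_of_tendsto (hψl ζ).abs (Eventually.of_forall fun b => hψM b ζ)
    have hP : ∀ x ∈ ball (c a) (r a), h x = PI φ ((r a)⁻¹ • (x - c a)) := by
      intro x hx
      have hstep : ∀ b, G (Nat.pair a b + 1) x = PI (ψ b) ((r a)⁻¹ • (x - c a)) := by
        intro b
        simp only [hG, sweep, Nat.unpair_pair]
        rw [if_pos ha, modif_in hx]
      have l1 : Tendsto (fun b => G (Nat.pair a b + 1) x) atTop (𝓝 (h x)) :=
        (hlim x (ha (ball_subset_closedBall hx))).comp ((tendsto_add_atTop_nat 1).comp hpair)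
      have l2 : Tendsto (fun b => PI (ψ b) ((r a)⁻¹ • (x - c a))) atTop
          (𝓝 (PI φ ((r a)⁻¹ • (x - c a)))) := by
        have := sig_prob hn
        set k : C(Sph n, ℝ) := PK ((r a)⁻¹ • (x - c a))
        refine tendsto_integral_of_dominated_convergence (fun _ => ‖k‖ * max M1 M2)
          (fun b => (k.continuous.mul (hψc b)).measurable.aestronglyMeasurable)
          (integrable_const _) (fun b => Eventually.of_forall fun ζ => ?_)
          (Eventually.of_forall fun ζ => (hψl ζ).const_mul _)
        rw [norm_mul]
        exact mul_le_mul (k.norm_coe_le_norm ζ) (hψM b ζ) (norm_nonneg _) (norm_nonneg _)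
      refine tendsto_nhds_unique l1 ?_
      simpa only [hstep] using l2
    obtain ⟨r1, r2⟩ := PI_affine hn hφm hφM (hr0 a) hza
    have hev : h =ᶠ[𝓝 z] (fun x => PI φ ((r a)⁻¹ • (x - c a))) := by
      filter_upwards [isOpen_ball.mem_nhds hza] with x hx using hP x hx
    exact ⟨r1.congr_of_eventuallyEq hev, (lapl_congr hev).trans r2⟩
  exact ⟨h, (harmonic_iff h Ω).2 ⟨fun z hz => (hloc z hz).1.contDiffWithinAt, fun z hz => (hloc z hz).2⟩,
    fun z hz => ⟨hgh z hz, hhW z hz⟩⟩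

theorem sandwich {g W : EuclideanSpace ℂ (Fin n) → ℝ}
    {Ω : Set (EuclideanSpace ℂ (Fin n))} (hΩ : IsOpen Ω)
    (hg : ContDiffOn ℝ 2 g Ω) (hgl : ∀ z ∈ Ω, 0 ≤ lapl g z)
    (hW : ContDiffOn ℝ 2 W Ω) (hWl : ∀ z ∈ Ω, lapl W z ≤ 0)
    (hgW : ∀ z ∈ Ω, g z ≤ W z) :
    ∃ h, HarmonicOnCn h Ω ∧ ∀ z ∈ Ω, g z ≤ h z ∧ h z ≤ W z := by
  rcases Nat.eq_zero_or_pos n with rfl | hn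
  · exact ⟨g, (harmonic_iff g Ω).2 ⟨hg, fun z _ => by simp [lapl]⟩, fun z hz => ⟨le_rfl, hgW z hz⟩⟩
  · exact sandwich_pos hn hΩ (subh_of_contDiff hΩ hg hgl) hW hWl hgW

end Part4


section Part5
open Filter Topology

variable {n : ℕ}

lemma holo_fderiv_apply {f : EuclideanSpace ℂ (Fin n) → ℂ} {Ω : Set (EuclideanSpace ℂ (Fin n))}
    (hΩ : IsOpen Ω) (hf : DifferentiableOn ℂ f Ω) (e : EuclideanSpace ℂ (Fin n)) :
    DifferentiableOn ℂ (fun x => fderiv ℂ f x e) Ω := by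
  intro z hz
  apply DifferentiableAt.differentiableWithinAt
  obtain ⟨R, hR, hRΩ⟩ := Metric.nhds_basis_closedBall.mem_iff.1 (hΩ.mem_nhds hz)
  obtain ⟨B, hB⟩ := (isCompact_closedBall z R).exists_bound_of_continuousOn (hf.continuousOn.mono hRΩ)
  set r := R / 4 with hr
  have hr0 : 0 < r := by positivity
  set ρ := r / (‖e‖ + 1) with hρ
  have hρ0 : 0 < ρ := by positivity
  have hρe : ρ * ‖e‖ ≤ r := by
    rw [hρ, div_mul_eq_mul_div, div_le_iff₀ (by positivity)]
    nlinarith [norm_nonneg e]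
  have hy : ∀ x ∈ Metric.ball z r, ∀ ζ : ℂ, ‖ζ‖ ≤ ρ → x + ζ • e ∈ Metric.closedBall z (2 * r) := by
    intro x hx ζ hζ
    rw [mem_closedBall_iff_norm]
    rw [mem_ball_iff_norm] at hx
    calc ‖x + ζ • e - z‖ = ‖(x - z) + ζ • e‖ := by congr 1; abel
      _ ≤ ‖x - z‖ + ‖ζ • e‖ := norm_add_le _ _
      _ ≤ r + ρ * ‖e‖ := by
        rw [norm_smul]; gcongr
      _ ≤ 2 * r := by linarith
  have hyΩ : ∀ x ∈ Metric.ball z r, ∀ ζ : ℂ, ‖ζ‖ ≤ ρ → x + ζ • e ∈ Ω := fun x hx ζ hζ =>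
    hRΩ (Metric.closedBall_subset_closedBall (by rw [hr]; linarith) (hy x hx ζ hζ))
  have hbd : ∀ y ∈ Metric.closedBall z (2 * r), ‖fderiv ℂ f y‖ ≤ (2 * B) / r := by
    intro y hyy
    have hsub : Metric.ball y r ⊆ Metric.closedBall z R := by
      intro w hw
      rw [Metric.mem_closedBall] at hyy ⊢
      rw [Metric.mem_ball] at hw
      have := dist_triangle w y z
      rw [hr] at *
      linarith
    refine Complex.norm_fderiv_le_div_of_mapsTo_ball (hf.mono (hsub.trans hRΩ)) ?_ hr0
    intro w hw
    rw [mem_closedBall_iff_norm]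
    have h1 := hB w (hsub hw)
    have h2 := hB y (hsub (Metric.mem_ball_self hr0))
    calc _ ≤ ‖f w‖ + ‖f y‖ := norm_sub_le _ _
      _ ≤ 2 * B := by linarith
  set c : ℝ → ℂ := circleMap 0 ρ with hc
  have hcn : ∀ θ, ‖c θ‖ = ρ := fun θ => by simp [hc, abs_of_pos hρ0]
  have hcc : Continuous c := continuous_circleMap 0 ρ
  set k : ℝ → ℂ := fun θ => deriv c θ * ((c θ - 0) ^ 2)⁻¹ with hk
  have hkc : Continuous k := by
    have : ∀ θ, (c θ - 0) ^ 2 ≠ 0 := by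
      intro θ
      have : c θ ≠ 0 := by
        rw [← norm_pos_iff, hcn]; exact hρ0
      simpa using this
    refine Continuous.mul ?_ (((hcc.sub continuous_const).pow 2).inv₀ this)
    have : deriv c = fun θ => circleMap 0 ρ θ * Complex.I := by
      ext θ; simp [hc, deriv_circleMap]
    rw [this]
    exact hcc.mul continuous_const
  have hrep : ∀ x ∈ Metric.ball z r, fderiv ℂ f x e =
      (2 * π * Complex.I : ℂ)⁻¹ • ∫ θ in (0:ℝ)..2 * π, k θ * f (x + c θ • e) := by
    intro x hx
    have hUo : IsOpen {ζ : ℂ | x + ζ • e ∈ Ω} := hΩ.preimage (by fun_prop)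
    have hd : DifferentiableOn ℂ (fun ζ : ℂ => f (x + ζ • e)) {ζ : ℂ | x + ζ • e ∈ Ω} := by
      refine hf.comp (t := Ω) ?_ (fun ζ h => h)
      exact Differentiable.differentiableOn (by fun_prop)
    have := Complex.two_pi_I_inv_smul_circleIntegral_sub_sq_inv_smul_of_differentiable hUo
      (c := (0:ℂ)) (R := ρ) (w₀ := 0) (fun ζ hζ => hyΩ x hx ζ (by simpa using hζ)) hd
      (Metric.mem_ball_self hρ0)
    have hder : HasDerivAt (fun ζ : ℂ => f (x + ζ • e)) (fderiv ℂ f x e) 0 := by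
      have hx' : x ∈ Ω := by simpa using hyΩ x hx 0 (by simpa using hρ0.le)
      have h1 : HasFDerivAt f (fderiv ℂ f x) (x + (0:ℂ) • e) := by
        simpa using (hf.differentiableAt (hΩ.mem_nhds hx')).hasFDerivAt
      have h2 : HasDerivAt (fun ζ : ℂ => x + ζ • e) e 0 := by
        simpa using ((hasDerivAt_id (0:ℂ)).smul_const e).const_add x
      exact h1.comp_hasDerivAt (0:ℂ) h2
    rw [hder.deriv] at this
    rw [← this]
    congr 1
    rw [circleIntegral]
    congr 1
    ext θ
    simp only [hk, smul_eq_mul, hc]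
    ring
  have hF : HasFDerivAt (fun x => ∫ θ in (0:ℝ)..2 * π, k θ * f (x + c θ • e))
      (∫ θ in (0:ℝ)..2 * π, k θ • fderiv ℂ f (z + c θ • e)) z := by
    have hcont : ∀ x ∈ Metric.ball z r, Continuous fun θ => k θ * f (x + c θ • e) := by
      intro x hx
      refine hkc.mul ?_
      refine hf.continuousOn.comp_continuous (by fun_prop) fun θ => hyΩ x hx _ (hcn θ).le
    refine intervalIntegral.hasFDerivAt_integral_of_dominated_of_fderiv_le
      (F' := fun x θ => k θ • fderiv ℂ f (x + c θ • e))
      (bound := fun θ => ‖k θ‖ * ((2 * B) / r)) (Metric.ball_mem_nhds z hr0) ?_ ?_ ?_ ?_ ?_ ?_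
    · filter_upwards [Metric.ball_mem_nhds z hr0] with x hx
      exact (hcont x hx).aestronglyMeasurable
    · exact (hcont z (Metric.mem_ball_self hr0)).intervalIntegrable _ _
    · borelize (EuclideanSpace ℂ (Fin n) →L[ℂ] ℂ)
      have h1 : Measurable fun θ => fderiv ℂ f (z + c θ • e) :=
        (measurable_fderiv ℂ f).comp (by fun_prop : Continuous fun θ => z + c θ • e).measurable
      have : SecondCountableTopology (EuclideanSpace ℂ (Fin n) →L[ℂ] ℂ) := by
        have : ProperSpace (EuclideanSpace ℂ (Fin n) →L[ℂ] ℂ) := FiniteDimensional.proper ℂ _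
        infer_instance
      exact (hkc.aestronglyMeasurable).smul h1.aestronglyMeasurable
    · refine Eventually.of_forall fun θ _ x hx => ?_
      rw [norm_smul]
      gcongr
      exact hbd _ (hy x hx _ (hcn θ).le)
    · exact (hkc.norm.mul continuous_const).intervalIntegrable _ _
    · refine Eventually.of_forall fun θ _ x hx => ?_
      have h1 := (hf.differentiableAt (hΩ.mem_nhds (hyΩ x hx _ (hcn θ).le))).hasFDerivAt
      have h2 : HasFDerivAt (fun x => f (x + c θ • e)) (fderiv ℂ f (x + c θ • e)) x :=
        h1.comp x ((hasFDerivAt_id x).add_const (c θ • e))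
      exact h2.const_mul (k θ)
  have := (hF.differentiableAt.const_smul ((2 * π * Complex.I : ℂ)⁻¹))
  refine this.congr_of_eventuallyEq ?_
  filter_upwards [Metric.ball_mem_nhds z hr0] with x hx
  exact hrep x hx

lemma holo_contDiffOn (k : ℕ) : ∀ {f : EuclideanSpace ℂ (Fin n) → ℂ}
    {Ω : Set (EuclideanSpace ℂ (Fin n))}
    (_ : IsOpen Ω) (_ : DifferentiableOn ℂ f Ω), ContDiffOn ℂ k f Ω := by
  induction k with
  | zero => intro f Ω hΩ hf; simpa using hf.continuousOn
  | succ k ih =>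
    intro f Ω hΩ hf
    have : ((k + 1 : ℕ) : WithTop ℕ∞) = (k : WithTop ℕ∞) + 1 := by norm_cast
    rw [this, contDiffOn_succ_iff_fderiv_of_isOpen hΩ]
    refine ⟨hf, by simp, ?_⟩
    rw [contDiffOn_clm_apply]
    intro e
    exact ih hΩ (holo_fderiv_apply hΩ hf e)

lemma holo_C2 {f : EuclideanSpace ℂ (Fin n) → ℂ} {Ω : Set (EuclideanSpace ℂ (Fin n))}
    (hΩ : IsOpen Ω) (hf : DifferentiableOn ℂ f Ω) : ContDiffOn ℝ 2 f Ω := by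
  have := holo_contDiffOn 2 hΩ hf
  exact (this.restrict_scalars ℝ)

/-- second derivative of a composition -/
lemma D2_comp {f : EuclideanSpace ℂ (Fin n) → ℂ} {N : ℂ → ℝ} (hN : ContDiff ℝ 2 N) {z}
    (hf : ContDiffAt ℝ 2 f z) (e : EuclideanSpace ℂ (Fin n)) :
    D2 (fun x => N (f x)) z e = D2 N (f z) (fderiv ℝ f z e) + fderiv ℝ N (f z) (D2 f z e) := by
  refine D2_eq (hN.contDiffAt.comp z hf)
    (d := fun t => fderiv ℝ N (f (z + t • e)) (fderiv ℝ f (z + t • e) e)) ?_ ?_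
  · filter_upwards [line_first hf e] with t ht
    exact ((hN.differentiable (by norm_num) _).hasFDerivAt).comp_hasDerivAt t ht
  · have h1 : HasDerivAt (fun t : ℝ => f (z + t • e)) (fderiv ℝ f z e) 0 := by
      simpa using (line_first hf e).self_of_nhds
    have h2 : Differentiable ℝ (fderiv ℝ N) :=
      (hN.fderiv_right (m := 1) (by norm_num)).differentiable (by norm_num)
    have h3 := ((h2 (f (z + (0:ℝ) • e))).hasFDerivAt).comp_hasDerivAt (0:ℝ) h1
    have h4 := h3.clm_apply (line_second hf e)
    simpa [D2] using h4

lemma D2_holo_I {f : EuclideanSpace ℂ (Fin n) → ℂ} {Ω : Set (EuclideanSpace ℂ (Fin n))}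
    (hΩ : IsOpen Ω) (hf : DifferentiableOn ℂ f Ω) {z} (hz : z ∈ Ω) (e : EuclideanSpace ℂ (Fin n)) :
    D2 f z (Complex.I • e) = - D2 f z e := by
  have hC : ContDiffAt ℝ 2 f z := (holo_C2 hΩ hf).contDiffAt (hΩ.mem_nhds hz)
  have hd : DifferentiableAt ℝ (fderiv ℝ f) z :=
    (hC.fderiv_right (m := 1) (by norm_num)).differentiableAt (by norm_num)
  have key : ∀ a b : EuclideanSpace ℂ (Fin n), fderiv ℝ (fderiv ℝ f) z a (Complex.I • b) =
      Complex.I * fderiv ℝ (fderiv ℝ f) z a b := by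
    intro a b
    have h1 : (fun x => fderiv ℝ f x (Complex.I • b)) =ᶠ[𝓝 z]
        fun x => Complex.I * fderiv ℝ f x b := by
      filter_upwards [hΩ.mem_nhds hz] with x hx
      have hx' := hf.differentiableAt (hΩ.mem_nhds hx)
      rw [hx'.fderiv_restrictScalars ℝ]
      simp
    have h2 : HasFDerivAt (fun x => fderiv ℝ f x (Complex.I • b)) _ z :=
      hd.hasFDerivAt.clm_apply (hasFDerivAt_const _ _)
    have h3 : HasFDerivAt (fun x => fderiv ℝ f x b) _ z :=
      hd.hasFDerivAt.clm_apply (hasFDerivAt_const _ _)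
    have h4 := (h2.congr_of_eventuallyEq h1.symm).unique (h3.const_mul Complex.I)
    have h5 := congrArg (fun L => L a) h4
    simpa using h5
  have sym : IsSymmSndFDerivAt ℝ f z := hC.isSymmSndFDerivAt (by simp)
  unfold D2
  rw [key, sym.eq, key, ← mul_assoc, Complex.I_mul_I]
  ring

lemma D2_conformal {N : ℂ → ℝ} (hN : ContDiff ℝ 2 N) (w a : ℂ) :
    D2 N w a + D2 N w (Complex.I * a) = ‖a‖ ^ 2 * (D2 N w 1 + D2 N w Complex.I) := by
  have sym : IsSymmSndFDerivAt ℝ N w := hN.contDiffAt.isSymmSndFDerivAt (by simp)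
  have h1 : a = a.re • (1:ℂ) + a.im • Complex.I := by
    apply Complex.ext <;> simp
  have h2 : Complex.I * a = (-a.im) • (1:ℂ) + a.re • Complex.I := by
    apply Complex.ext <;> simp
  have h3 : ‖a‖ ^ 2 = a.re ^ 2 + a.im ^ 2 := by
    rw [Complex.sq_norm, Complex.normSq_apply]; ring
  rw [h3]
  unfold D2
  rw [h2]
  conv_lhs => enter [1]; rw [h1]
  simp only [map_add, map_smul, ContinuousLinearMap.add_apply, ContinuousLinearMap.smul_apply,
    smul_eq_mul]
  rw [sym.eq Complex.I 1]
  ring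

lemma lapl_comp {f : EuclideanSpace ℂ (Fin n) → ℂ} {Ω : Set (EuclideanSpace ℂ (Fin n))}
    (hΩ : IsOpen Ω) (hf : DifferentiableOn ℂ f Ω) {z} (hz : z ∈ Ω) {N : ℂ → ℝ}
    (hN : ContDiff ℝ 2 N) :
    lapl (fun x => N (f x)) z = (∑ j, ‖fderiv ℝ f z (EuclideanSpace.single j 1)‖ ^ 2) *
      (D2 N (f z) 1 + D2 N (f z) Complex.I) := by
  have hC : ContDiffAt ℝ 2 f z := (holo_C2 hΩ hf).contDiffAt (hΩ.mem_nhds hz)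
  unfold lapl
  rw [Finset.sum_mul]
  refine Finset.sum_congr rfl fun j _ => ?_
  have hI : EuclideanSpace.single j Complex.I =
      Complex.I • (EuclideanSpace.single j 1 : EuclideanSpace ℂ (Fin n)) := by
    ext i; simp [EuclideanSpace.single_apply]
  have hfI : fderiv ℝ f z (Complex.I • (EuclideanSpace.single j 1 : EuclideanSpace ℂ (Fin n))) =
      Complex.I * fderiv ℝ f z (EuclideanSpace.single j 1) := by
    rw [(hf.differentiableAt (hΩ.mem_nhds hz)).fderiv_restrictScalars ℝ]
    simp
  rw [hI, D2_comp hN hC, D2_comp hN hC, D2_holo_I hΩ hf hz, hfI, ← D2_conformal hN, map_neg]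
  ring

end Part5


section Part6
open Filter Topology

/-- two-jet of a function of one real variable at zero -/
def Jet (g : ℝ → ℝ) (g1 g2 : ℝ) : Prop :=
  ∃ d : ℝ → ℝ, (∀ t, HasDerivAt g (d t) t) ∧ d 0 = g1 ∧ HasDerivAt d g2 0

lemma Jet.mul {g h : ℝ → ℝ} {g1 g2 h1 h2 : ℝ} (hg : Jet g g1 g2) (hh : Jet h h1 h2) :
    Jet (fun t => g t * h t) (g1 * h 0 + g 0 * h1) (g2 * h 0 + 2 * (g1 * h1) + g 0 * h2) := by
  obtain ⟨d, hd, rfl, hd2⟩ := hg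
  obtain ⟨k, hk, rfl, hk2⟩ := hh
  refine ⟨fun t => d t * h t + g t * k t, fun t => (hd t).mul (hk t), rfl, ?_⟩
  have := (hd2.mul (hk 0)).add ((hd 0).mul hk2)
  exact this.congr_deriv (by ring)

lemma Jet.rpow {g : ℝ → ℝ} {g1 g2 : ℝ} (hg : Jet g g1 g2) (hpos : ∀ t, 0 < g t) (q : ℝ) :
    Jet (fun t => g t ^ q) (q * g 0 ^ (q - 1) * g1)
      (q * (q - 1) * g 0 ^ (q - 2) * g1 ^ 2 + q * g 0 ^ (q - 1) * g2) := by
  obtain ⟨d, hd, rfl, hd2⟩ := hg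
  refine ⟨fun t => d t * q * g t ^ (q - 1), fun t => (hd t).rpow_const (Or.inl (hpos t).ne'),
    by ring, ?_⟩
  have := (hd2.mul_const q).mul ((hd 0).rpow_const (p := q - 1) (Or.inl (hpos 0).ne'))
  refine this.congr_deriv ?_
  rw [show q - 1 - 1 = q - 2 by ring]
  ring

lemma Jet.const_mul {g : ℝ → ℝ} {g1 g2 : ℝ} (hg : Jet g g1 g2) (c : ℝ) :
    Jet (fun t => c * g t) (c * g1) (c * g2) := by
  obtain ⟨d, hd, rfl, hd2⟩ := hg
  exact ⟨fun t => c * d t, fun t => (hd t).const_mul c, rfl, hd2.const_mul c⟩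

lemma Jet.sub {g h : ℝ → ℝ} {g1 g2 h1 h2 : ℝ} (hg : Jet g g1 g2) (hh : Jet h h1 h2) :
    Jet (fun t => g t - h t) (g1 - h1) (g2 - h2) := by
  obtain ⟨d, hd, rfl, hd2⟩ := hg
  obtain ⟨k, hk, rfl, hk2⟩ := hh
  exact ⟨fun t => d t - k t, fun t => (hd t).sub (hk t), rfl, hd2.sub hk2⟩

lemma Jet.sq_add (a c : ℝ) : Jet (fun t => (a + t) ^ 2 + c) (2 * a) 2 := by
  refine ⟨fun t => 2 * (a + t), fun t => ?_, by ring, ?_⟩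
  · have := (((hasDerivAt_id t).const_add a).pow 2).add_const c
    simpa using this
  · simpa using (((hasDerivAt_id (0:ℝ)).const_add a).const_mul 2)

lemma Jet.const (c : ℝ) : Jet (fun _ => c) 0 0 :=
  ⟨fun _ => 0, fun t => hasDerivAt_const t c, rfl, hasDerivAt_const _ _⟩

lemma Jet.D2 {f : ℂ → ℝ} {w e : ℂ} (h : ContDiff ℝ 2 f) {g : ℝ → ℝ} {g1 g2 : ℝ} (hg : Jet g g1 g2)
    (he : ∀ t : ℝ, f (w + t • e) = g t) : D2 f w e = g2 := by
  obtain ⟨d, hd, -, hd2⟩ := hg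
  refine D2_eq h.contDiffAt (Eventually.of_forall fun t => ?_) hd2
  have : (fun t : ℝ => f (w + t • e)) = g := funext he
  rw [this]; exact hd t

noncomputable def RR (δ : ℝ) (w : ℂ) : ℝ := w.re ^ 2 + (w.im ^ 2 + δ)
noncomputable def SS (δ : ℝ) (w : ℂ) : ℝ := w.re ^ 2 + δ

variable {δ : ℝ}

lemma re_CD : ContDiff ℝ 2 (fun w : ℂ => w.re) := Complex.reCLM.contDiff
lemma im_CD : ContDiff ℝ 2 (fun w : ℂ => w.im) := Complex.imCLM.contDiff

lemma RR_pos (hδ : 0 < δ) (w : ℂ) : 0 < RR δ w := by unfold RR; positivity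
lemma SS_pos (hδ : 0 < δ) (w : ℂ) : 0 < SS δ w := by unfold SS; positivity

lemma RR_CD (hδ : 0 < δ) (q : ℝ) : ContDiff ℝ 2 (fun w => RR δ w ^ q) :=
  ContDiff.rpow_const_of_ne
    (f := RR δ) ((re_CD.pow 2).add ((im_CD.pow 2).add contDiff_const)) fun w => (RR_pos hδ w).ne'

lemma SS_CD (hδ : 0 < δ) (q : ℝ) : ContDiff ℝ 2 (fun w => SS δ w ^ q) :=
  ContDiff.rpow_const_of_ne
    (f := SS δ) ((re_CD.pow 2).add contDiff_const) fun w => (SS_pos hδ w).ne'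

lemma RR_jet1 (hδ : 0 < δ) (w : ℂ) (q : ℝ) :
    Jet (fun t : ℝ => RR δ (w + t • (1:ℂ)) ^ q) (q * RR δ w ^ (q - 1) * (2 * w.re))
      (q * (q - 1) * RR δ w ^ (q - 2) * (2 * w.re) ^ 2 + q * RR δ w ^ (q - 1) * 2) := by
  have := (Jet.sq_add w.re (w.im ^ 2 + δ)).rpow (fun t => by positivity) q
  simpa [RR] using this

lemma RR_jetI (hδ : 0 < δ) (w : ℂ) (q : ℝ) :
    Jet (fun t : ℝ => RR δ (w + t • Complex.I) ^ q) (q * RR δ w ^ (q - 1) * (2 * w.im))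
      (q * (q - 1) * RR δ w ^ (q - 2) * (2 * w.im) ^ 2 + q * RR δ w ^ (q - 1) * 2) := by
  have := (Jet.sq_add w.im (w.re ^ 2 + δ)).rpow (fun t => by positivity) q
  simpa [RR, add_left_comm] using this

lemma SS_jet1 (hδ : 0 < δ) (w : ℂ) (q : ℝ) :
    Jet (fun t : ℝ => SS δ (w + t • (1:ℂ)) ^ q) (q * SS δ w ^ (q - 1) * (2 * w.re))
      (q * (q - 1) * SS δ w ^ (q - 2) * (2 * w.re) ^ 2 + q * SS δ w ^ (q - 1) * 2) := by
  have := (Jet.sq_add w.re δ).rpow (fun t => by positivity) q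
  simpa [SS] using this

lemma SS_jetI (w : ℂ) (q : ℝ) :
    Jet (fun t : ℝ => SS δ (w + t • Complex.I) ^ q) 0 0 := by
  have := Jet.const (SS δ w ^ q)
  simpa [SS] using this

lemma sq_jet1 (w : ℂ) : Jet (fun t : ℝ => (w + t • (1:ℂ)).re ^ 2) (2 * w.re) 2 := by
  simpa using Jet.sq_add w.re 0

lemma sq_jetI (w : ℂ) : Jet (fun t : ℝ => (w + t • Complex.I).re ^ 2) 0 0 := by
  simpa using Jet.const (w.re ^ 2)

lemma rpow_step {x : ℝ} (hx : 0 < x) (a : ℝ) : x ^ (a - 1) = x ^ (a - 2) * x := by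
  rw [show a - 1 = (a - 2) + 1 by ring, rpow_add hx, rpow_one]

lemma rpow_step' {x : ℝ} (hx : 0 < x) (a : ℝ) : x ^ a = x ^ (a - 1) * x := by
  rw [show a = (a - 1) + 1 by ring, rpow_add hx, rpow_one]; simp

lemma lapl_RR (hδ : 0 < δ) (w : ℂ) (q : ℝ) :
    D2 (fun w => RR δ w ^ q) w 1 + D2 (fun w => RR δ w ^ q) w Complex.I =
      4 * q * RR δ w ^ (q - 2) * (q * RR δ w + (1 - q) * δ) := by
  rw [Jet.D2 (RR_CD hδ q) (RR_jet1 hδ w q) (fun _ => rfl),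
    Jet.D2 (RR_CD hδ q) (RR_jetI hδ w q) (fun _ => rfl), rpow_step (RR_pos hδ w)]
  unfold RR
  ring

lemma norm_rpow_eq {q p : ℝ} (hq : p = 2 * q) (x : ℝ) (hx : 0 ≤ x) : x ^ p = (x ^ 2) ^ q := by
  rw [hq, rpow_mul hx]; norm_cast

lemma norm_le_RR {q p : ℝ} (hq : p = 2 * q) (hq0 : 0 ≤ q) (hδ : 0 < δ) (w : ℂ) :
    ‖w‖ ^ p ≤ RR δ w ^ q := by
  rw [norm_rpow_eq hq _ (norm_nonneg _)]
  refine rpow_le_rpow (by positivity) ?_ hq0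
  rw [Complex.sq_norm, Complex.normSq_apply, RR]; nlinarith

lemma lapl_RR_nonneg (hδ : 0 < δ) (w : ℂ) {q : ℝ} (hq : 0 ≤ q) :
    0 ≤ D2 (fun w => RR δ w ^ q) w 1 + D2 (fun w => RR δ w ^ q) w Complex.I := by
  rw [lapl_RR hδ]
  have h1 := RR_pos hδ w
  have h2 : δ ≤ RR δ w := by unfold RR; nlinarith [sq_nonneg w.re, sq_nonneg w.im]
  have h3 : 0 ≤ q * RR δ w + (1 - q) * δ := by nlinarith
  have := rpow_pos_of_pos h1 (q - 2)
  positivity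

lemma aux_small {p : ℝ} (hp : 1 < p) (hp2 : p ≤ 2) : ∃ A : ℝ, 0 < A ∧ ∀ (M η : ℝ), 0 < η →
    ∃ G N : ℂ → ℝ, ContDiff ℝ 2 G ∧ ContDiff ℝ 2 N ∧ (∀ w, 0 ≤ D2 G w 1 + D2 G w Complex.I) ∧
    (∀ w, D2 N w 1 + D2 N w Complex.I ≤ 0) ∧ (∀ w, ‖w‖ ^ p ≤ G w) ∧
    (∀ w, G w ≤ N w + A * |w.re| ^ p + η) ∧ N (M : ℂ) ≤ η := by
  obtain ⟨q, hq⟩ : ∃ q, p = 2 * q := ⟨p / 2, by ring⟩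
  have hq0 : 0 < q := by linarith
  have hq1 : q ≤ 1 := by linarith
  have hq2 : 0 < 2 * q - 1 := by linarith
  set A := 2 / (2 * q - 1) with hA
  have hA0 : 0 < A := by positivity
  have hA1 : A * (2 * q - 1) = 2 := by rw [hA]; field_simp
  have hA2 : 1 ≤ A := by
    rw [hA, le_div_iff₀ hq2]; linarith
  refine ⟨A, hA0, fun M η hη => ?_⟩
  set δ := (η / A) ^ (1 / q) with hδd
  have hδ : 0 < δ := by positivity
  have hδq : δ ^ q = η / A := by
    rw [hδd, ← rpow_mul (by positivity), one_div_mul_cancel hq0.ne', rpow_one]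
  have hN : ContDiff ℝ 2 fun w => RR δ w ^ q - A * SS δ w ^ q :=
    (RR_CD hδ q).sub (contDiff_const.mul (SS_CD hδ q))
  refine ⟨fun w => RR δ w ^ q, fun w => RR δ w ^ q - A * SS δ w ^ q, RR_CD hδ q, hN,
    fun w => lapl_RR_nonneg hδ w hq0.le, fun w => ?_, fun w => norm_le_RR hq hq0.le hδ w,
    fun w => ?_, ?_⟩
  · have hR := RR_pos hδ w
    have hS := SS_pos hδ w
    have hSR : SS δ w ≤ RR δ w := by unfold SS RR; nlinarith [sq_nonneg w.im]
    rw [Jet.D2 hN ((RR_jet1 hδ w q).sub ((SS_jet1 hδ w q).const_mul A)) (fun _ => rfl),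
      Jet.D2 hN ((RR_jetI hδ w q).sub ((SS_jetI w q).const_mul A)) (fun _ => rfl)]
    have hmono : RR δ w ^ (q - 1) ≤ SS δ w ^ (q - 1) :=
      rpow_le_rpow_of_nonpos hS hSR (by linarith)
    have hr2 := rpow_pos_of_pos hR (q - 2)
    have hs2 := rpow_pos_of_pos hS (q - 2)
    have hs1 := rpow_pos_of_pos hS (q - 1)
    have e1 : q * (q - 1) * RR δ w ^ (q - 2) * ((2 * w.re) ^ 2 + (2 * w.im) ^ 2) ≤ 0 := by
      have : 0 ≤ q * (1 - q) * RR δ w ^ (q - 2) * ((2 * w.re) ^ 2 + (2 * w.im) ^ 2) := by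
        have : 0 ≤ 1 - q := by linarith
        positivity
      linarith
    have e2 : q * (q - 1) * SS δ w ^ (q - 2) * (2 * w.re) ^ 2 ≥
        4 * (q * (q - 1)) * SS δ w ^ (q - 1) := by
      rw [rpow_step hS]
      have : 0 ≤ 4 * (q * (1 - q) * SS δ w ^ (q - 2)) * δ := by
        have : 0 ≤ 1 - q := by linarith
        positivity
      unfold SS at *
      nlinarith
    have e3 : A * (q * (q - 1) * SS δ w ^ (q - 2) * (2 * w.re) ^ 2 + q * SS δ w ^ (q - 1) * 2) ≥
        4 * q * SS δ w ^ (q - 1) := by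
      calc _ ≥ A * (4 * (q * (q - 1)) * SS δ w ^ (q - 1) + q * SS δ w ^ (q - 1) * 2) := by
            gcongr
        _ = (A * (2 * q - 1)) * (2 * q * SS δ w ^ (q - 1)) := by ring
        _ = _ := by rw [hA1]; ring
    have e4 := mul_le_mul_of_nonneg_left hmono hq0.le
    linarith
  · have h1 : SS δ w ^ q ≤ |w.re| ^ p + δ ^ q := by
      rw [norm_rpow_eq hq _ (abs_nonneg _), sq_abs]
      exact rpow_add_le_add_rpow (by positivity) hδ.le hq0.le hq1
    rw [hδq] at h1
    have h2 := mul_le_mul_of_nonneg_left h1 hA0.le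
    have h3 : A * (η / A) = η := by field_simp
    rw [mul_add, h3] at h2
    linarith
  · have h1 : RR δ (M : ℂ) = SS δ (M : ℂ) := by simp [RR, SS]
    have h2 := rpow_pos_of_pos (SS_pos hδ (M : ℂ)) q
    simp only [h1]
    nlinarith

lemma aux_large {p : ℝ} (hp2 : 2 ≤ p) : ∃ A : ℝ, 0 < A ∧ ∀ (M η : ℝ), 0 < η →
    ∃ G N : ℂ → ℝ, ContDiff ℝ 2 G ∧ ContDiff ℝ 2 N ∧ (∀ w, 0 ≤ D2 G w 1 + D2 G w Complex.I) ∧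
    (∀ w, D2 N w 1 + D2 N w Complex.I ≤ 0) ∧ (∀ w, ‖w‖ ^ p ≤ G w) ∧
    (∀ w, G w ≤ N w + A * |w.re| ^ p + η) ∧ N (M : ℂ) ≤ η := by
  obtain ⟨q, hq⟩ : ∃ q, p = 2 * q := ⟨p / 2, by ring⟩
  have hq1 : 1 ≤ q := by linarith
  have hq0 : 0 < q := by linarith
  have hs0 : 0 ≤ q - 1 := by linarith
  set b := 2 * q ^ 2 with hb
  have hb1 : 1 ≤ b := by rw [hb]; nlinarith
  refine ⟨(2 * b) ^ q, by positivity, fun M η hη => ?_⟩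
  set K := (M ^ 2 + 1) ^ (q - 1) with hK
  have hK0 : 0 < K := by positivity
  set δ := min 1 (η / (2 * K)) with hδd
  have hδ : 0 < δ := by positivity
  have hδ1 : δ ≤ 1 := min_le_left _ _
  have hδ2 : 2 * K * δ ≤ η := by
    have : δ ≤ η / (2 * K) := min_le_right _ _
    rw [le_div_iff₀ (by positivity)] at this
    linarith
  have hN : ContDiff ℝ 2 fun w : ℂ => 2 * RR δ w ^ q - 2 * b * (w.re ^ 2 * RR δ w ^ (q - 1)) :=
    (contDiff_const.mul (RR_CD hδ q)).sub (contDiff_const.mul ((re_CD.pow 2).mul (RR_CD hδ _)))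
  refine ⟨fun w => RR δ w ^ q, _, RR_CD hδ q, hN,
    fun w => lapl_RR_nonneg hδ w hq0.le, fun w => ?_, fun w => norm_le_RR hq hq0.le hδ w,
    fun w => ?_, ?_⟩
  · have hR := RR_pos hδ w
    have hRδ : δ ≤ RR δ w := by unfold RR; nlinarith [sq_nonneg w.re, sq_nonneg w.im]
    rw [Jet.D2 hN (((RR_jet1 hδ w q).const_mul 2).sub
        (((sq_jet1 w).mul (RR_jet1 hδ w (q - 1))).const_mul (2 * b))) (fun _ => rfl),
      Jet.D2 hN (((RR_jetI hδ w q).const_mul 2).sub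
        (((sq_jetI w).mul (RR_jetI hδ w (q - 1))).const_mul (2 * b))) (fun _ => rfl)]
    simp only [zero_smul, add_zero]
    set X := RR δ w ^ (q - 1 - 2) with hX
    have hX0 : 0 < X := rpow_pos_of_pos hR _
    have x1 : RR δ w ^ (q - 1 - 1) = X * RR δ w := rpow_step hR _
    have x2 : RR δ w ^ (q - 2) = X * RR δ w := by rw [← x1]; congr 1; ring
    have x3 : RR δ w ^ (q - 1) = X * RR δ w ^ 2 := by rw [rpow_step hR, x2]; ring
    rw [x1, x2, x3]
    set R := RR δ w with hRd
    have hv : w.im ^ 2 = R - w.re ^ 2 - δ := by rw [hRd, RR]; ring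
    have t1 : 0 ≤ w.re ^ 2 * (q - 1) * X * R := by positivity
    have t2 : 0 ≤ w.re ^ 2 * (q - 1) * X * ((q - 1) * R + (2 - q) * δ) := by
      have : 0 ≤ (q - 1) * R + (2 - q) * δ := by nlinarith
      positivity
    have t3 : 0 ≤ q * (q - 1) * X * R * δ := by positivity
    have t1' : 0 ≤ b * (w.re ^ 2 * (q - 1) * X * R) := by positivity
    have t2' : 0 ≤ b * (w.re ^ 2 * (q - 1) * X * ((q - 1) * R + (2 - q) * δ)) := by positivity
    have goal_eq : (2 * (q * (q - 1) * (X * R) * (2 * w.re) ^ 2 + q * (X * R ^ 2) * 2) -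
        2 * b * (2 * (X * R ^ 2) + 2 * (2 * w.re * ((q - 1) * (X * R) * (2 * w.re))) +
          w.re ^ 2 * ((q - 1) * (q - 1 - 1) * X * (2 * w.re) ^ 2 + (q - 1) * (X * R) * 2))) +
        (2 * (q * (q - 1) * (X * R) * (2 * w.im) ^ 2 + q * (X * R ^ 2) * 2) -
        2 * b * (0 * (X * R ^ 2) + 2 * (0 * ((q - 1) * (X * R) * (2 * w.im))) +
          w.re ^ 2 * ((q - 1) * (q - 1 - 1) * X * (2 * w.im) ^ 2 + (q - 1) * (X * R) * 2))) =
        - 8 * (q * (q - 1) * X * R * δ) - 16 * (b * (w.re ^ 2 * (q - 1) * X * R))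
        - 8 * (b * (w.re ^ 2 * (q - 1) * X * ((q - 1) * R + (2 - q) * δ))) := by
      simp only [mul_pow, hv]
      rw [hb]
      ring
    rw [goal_eq]
    linarith
  · have hR := RR_pos hδ w
    rw [norm_rpow_eq hq _ (abs_nonneg _), sq_abs, ← mul_rpow (by positivity) (by positivity)]
    have hq' := rpow_step' hR q
    have hRs := rpow_pos_of_pos hR (q - 1)
    suffices h : 2 * b * w.re ^ 2 * RR δ w ^ (q - 1) ≤ RR δ w ^ q + (2 * b * w.re ^ 2) ^ q by
      simp only; linarith
    have hnn : 0 ≤ (2 * b * w.re ^ 2) ^ q := by positivity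
    rcases le_total (2 * b * w.re ^ 2) (RR δ w) with h | h
    · rw [hq']; nlinarith
    · have h1 : RR δ w ^ (q - 1) ≤ (2 * b * w.re ^ 2) ^ (q - 1) := rpow_le_rpow hR.le h hs0
      rw [rpow_step' (hR.trans_le h) q]
      have h2 := mul_le_mul_of_nonneg_left h1 (hR.trans_le h).le
      have h3 := rpow_pos_of_pos hR q
      linarith
  · have hR := RR_pos hδ (M : ℂ)
    have hRM : RR δ (M : ℂ) = M ^ 2 + δ := by simp [RR]
    simp only [Complex.ofReal_re]
    rw [rpow_step' hR q]
    have h1 : RR δ (M : ℂ) ^ (q - 1) ≤ K := by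
      rw [hK]; exact rpow_le_rpow hR.le (by rw [hRM]; linarith) hs0
    have hRs := rpow_pos_of_pos hR (q - 1)
    set Y := RR δ (M : ℂ) ^ (q - 1)
    rw [hRM]
    have h2 : Y * δ ≤ K * δ := by gcongr
    have h3 : 0 ≤ Y * ((b - 1) * M ^ 2) := by
      have : 0 ≤ b - 1 := by linarith
      positivity
    nlinarith

lemma aux_exists {p : ℝ} (hp : 1 < p) : ∃ A : ℝ, 0 < A ∧ ∀ (M η : ℝ), 0 < η →
    ∃ G N : ℂ → ℝ, ContDiff ℝ 2 G ∧ ContDiff ℝ 2 N ∧ (∀ w, 0 ≤ D2 G w 1 + D2 G w Complex.I) ∧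
    (∀ w, D2 N w 1 + D2 N w Complex.I ≤ 0) ∧ (∀ w, ‖w‖ ^ p ≤ G w) ∧
    (∀ w, G w ≤ N w + A * |w.re| ^ p + η) ∧ N (M : ℂ) ≤ η := by
  rcases le_total p 2 with h | h
  · exact aux_small hp h
  · exact aux_large h

end Part6


section Part7
open Filter Topology

lemma riesz_main {p A : ℝ} (hA0 : 0 < A) (hA : ∀ (M η : ℝ), 0 < η →
    ∃ G N : ℂ → ℝ, ContDiff ℝ 2 G ∧ ContDiff ℝ 2 N ∧ (∀ w, 0 ≤ D2 G w 1 + D2 G w Complex.I) ∧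
    (∀ w, D2 N w 1 + D2 N w Complex.I ≤ 0) ∧ (∀ w, ‖w‖ ^ p ≤ G w) ∧
    (∀ w, G w ≤ N w + A * |w.re| ^ p + η) ∧ N (M : ℂ) ≤ η)
    {n : ℕ} {Ω : Set (EuclideanSpace ℂ (Fin n))} (hΩ : IsOpen Ω) {z₀} (hz₀ : z₀ ∈ Ω)
    {f : EuclideanSpace ℂ (Fin n) → ℂ} (hf : DifferentiableOn ℂ f Ω) (him : (f z₀).im = 0)
    {U} (hU : HarmonicOnCn U Ω) (hfU : ∀ z ∈ Ω, |(f z).re| ^ p ≤ U z) {η : ℝ} (hη : 0 < η) :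
    ∃ F, HarmonicOnCn F Ω ∧ (∀ z ∈ Ω, ‖f z‖ ^ p ≤ F z) ∧ F z₀ ≤ A * U z₀ + 2 * η := by
  obtain ⟨G, N, hG, hN, hGl, hNl, h1, h2, h3⟩ := hA (f z₀).re η hη
  rw [harmonic_iff] at hU
  have hfC := holo_C2 hΩ hf
  have hfz : f z₀ = ((f z₀).re : ℂ) := by apply Complex.ext <;> simp [him]
  have hNf : ContDiffOn ℝ 2 (fun z => N (f z)) Ω := hN.comp_contDiffOn hfC
  have hAU : ContDiffOn ℝ 2 (fun z => A * U z) Ω := contDiffOn_const.mul hU.1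
  have hAU' : ContDiffOn ℝ 2 (fun z => A * U z + η) Ω := hAU.add contDiffOn_const
  obtain ⟨F, hF, hF2⟩ := sandwich (g := fun z => G (f z)) (W := fun z => (A * U z + η) + N (f z)) hΩ
    (hG.comp_contDiffOn hfC)
    (fun z hz => by
      rw [lapl_comp hΩ hf hz hG]
      exact mul_nonneg (Finset.sum_nonneg fun _ _ => by positivity) (hGl _))
    (hAU'.add hNf)
    (fun z hz => by
      have hn := hΩ.mem_nhds hz
      rw [lapl_add (hAU'.contDiffAt hn) (hNf.contDiffAt hn),
        lapl_add (hAU.contDiffAt hn) contDiffAt_const, lapl_const_mul (hU.1.contDiffAt hn),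
        hU.2 z hz, lapl_const, lapl_comp hΩ hf hz hN]
      have := mul_nonpos_of_nonneg_of_nonpos
        (Finset.sum_nonneg fun j (_ : j ∈ Finset.univ) =>
          (by positivity : 0 ≤ ‖fderiv ℝ f z (EuclideanSpace.single j 1)‖ ^ 2)) (hNl (f z))
      linarith)
    (fun z hz => by
      have := mul_le_mul_of_nonneg_left (hfU z hz) hA0.le
      have := h2 (f z)
      linarith)
  refine ⟨F, hF, fun z hz => (h1 _).trans (hF2 z hz).1, ?_⟩
  have := (hF2 z₀ hz₀).2
  rw [← hfz] at h3
  linarith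

end Part7

/-- **M. Riesz's theorem for arbitrary domains in `ℂⁿ`** (Theorem 1.5).
If `f = u + iv` is holomorphic on a domain `Ω ⊆ ℂⁿ` with `v z₀ = 0` and `|u|^p` admits a harmonic
majorant (`1 < p < ∞`), then `|f|^p` admits a harmonic majorant and
`‖f‖_{p,z₀}^p ≤ C_p^p ‖u‖_{p,z₀}^p`, where `C_p` depends only on `p`. -/
theorem riesz_domains_Cn (p : ℝ) (hp : 1 < p) :
    ∃ C : ℝ, 0 < C ∧
      ∀ (n : ℕ) (Ω : Set (EuclideanSpace ℂ (Fin n))), IsOpen Ω → IsConnected Ω →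
        ∀ z₀ ∈ Ω, ∀ f : EuclideanSpace ℂ (Fin n) → ℂ,
          DifferentiableOn ℂ f Ω → (f z₀).im = 0 →
          (∃ U, HarmonicOnCn U Ω ∧ ∀ z ∈ Ω, |(f z).re| ^ p ≤ U z) →
          (∃ F, HarmonicOnCn F Ω ∧ ∀ z ∈ Ω, ‖f z‖ ^ p ≤ F z) ∧
          sInf {y | ∃ F, HarmonicOnCn F Ω ∧ (∀ z ∈ Ω, ‖f z‖ ^ p ≤ F z) ∧ F z₀ = y}
            ≤ C ^ p *
              sInf {y | ∃ U, HarmonicOnCn U Ω ∧ (∀ z ∈ Ω, |(f z).re| ^ p ≤ U z) ∧ U z₀ = y} := by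
  obtain ⟨A, hA0, hA⟩ := aux_exists hp
  refine ⟨A ^ (1 / p), by positivity, ?_⟩
  intro n Ω hΩ _ z₀ hz₀ f hf him hex
  have hC : (A ^ (1 / p)) ^ p = A := by
    rw [← rpow_mul hA0.le, one_div_mul_cancel (by linarith), rpow_one]
  rw [hC]
  obtain ⟨U₀, hU₀, hfU₀⟩ := hex
  constructor
  · obtain ⟨F, hF, hF1, -⟩ := riesz_main hA0 hA hΩ hz₀ hf him hU₀ hfU₀ one_pos
    exact ⟨F, hF, hF1⟩
  · rw [← div_le_iff₀' hA0]
    refine le_csInf ⟨U₀ z₀, U₀, hU₀, hfU₀, rfl⟩ ?_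
    rintro y ⟨U, hU, hfU, rfl⟩
    rw [div_le_iff₀' hA0]
    refine le_of_forall_pos_le_add fun η hη => ?_
    obtain ⟨F, hF, hF1, hF2⟩ := riesz_main hA0 hA hΩ hz₀ hf him hU hfU (half_pos hη)
    refine le_trans (csInf_le ⟨0, ?_⟩ ⟨F, hF, hF1, rfl⟩) (by linarith)
    rintro y ⟨F', -, hF', rfl⟩
    exact le_trans (by positivity) (hF' z₀ hz₀)
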